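/- arXiv:1305.6582 — 4 statements merged into one kernel-verified Lean document; each statement's English description precedes it below -/
import Mathlib

section
/- Let A be a unital associative ℂ-algebra, let k, k' : A → A be unital ℂ-algebra endomorphisms, and let e, e' : A → A be ℂ-linear maps satisfying the twisted Leibniz rules e(ab) = a·e(b) + e(a)·k(b) and e'(ab) = a·e'(b) + e'(a)·k'(b) for all a, b ∈ A, together with the operator identities k∘e = q²·e∘k, k∘e' = q⁻¹·e'∘k, k'∘e' = q²·e'∘k', k'∘e = q⁻¹·e∘k', and k∘k' = k'∘k on A. Define the operator S = e∘e∘e' − (q + q⁻¹)·e∘e'∘e + e'∘e∘e. If x, y ∈ A satisfy S(x) = 0 and S(y) = 0, then S(x·y) = 0. -/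
/-- Quantum Serre relation propagation: if the quantum Serre operator
`S = e∘e∘e' − (q + q⁻¹)·e∘e'∘e + e'∘e∘e` annihilates `x` and `y`, it annihilates `x·y`. -/
theorem serre_propagation (q : ℂ) (hq : q ≠ 0) (hq' : ∀ N : ℕ, 0 < N → q ^ N ≠ 1)
    {A : Type*} [Ring A] [Algebra ℂ A]
    (k k' : A →ₐ[ℂ] A) (e e' : A →ₗ[ℂ] A)
    (he : ∀ a b : A, e (a * b) = a * e b + e a * k b)
    (he' : ∀ a b : A, e' (a * b) = a * e' b + e' a * k' b)
    (hke : ∀ a : A, k (e a) = q ^ 2 • e (k a))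
    (hke' : ∀ a : A, k (e' a) = q⁻¹ • e' (k a))
    (hk'e' : ∀ a : A, k' (e' a) = q ^ 2 • e' (k' a))
    (hk'e : ∀ a : A, k' (e a) = q⁻¹ • e (k' a))
    (hkk' : ∀ a : A, k (k' a) = k' (k a))
    (S : A → A)
    (hS : ∀ a : A, S a = e (e (e' a)) - (q + q⁻¹) • e (e' (e a)) + e' (e (e a)))
    (x y : A) (hx : S x = 0) (hy : S y = 0) : S (x * y) = 0 := by
  have key : S (x * y) = x * S y + S x * k' (k (k y)) := by
    simp only [hS, he, he', map_add, map_smul, hke, hke', hk'e, hkk', mul_add, add_mul,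
      mul_sub, sub_mul, smul_mul_assoc, mul_smul_comm]
    match_scalars <;> field_simp <;> ring
  rw [key, hx, hy, mul_zero, zero_mul, add_zero]
end

section
/- Every module-algebra structure of U_q(sl(3)) on the quantum plane A_q(2) is isomorphic to exactly one of the following, where (i,j) = (1,2) or (i,j) = (2,1) and all values of e_i, e_j, f_i, f_j on generators not listed are zero: (I) k_i(x_1) = ε₁x_1, k_i(x_2) = ε₂x_2, k_j(x_1) = δ₁x_1, k_j(x_2) = δ₂x_2 with ε₁, ε₂, δ₁, δ₂ ∈ {1, −1}, and e_i, e_j, f_i, f_j all zero on x_1, x_2; (II) k_i(x_1) = q⁻²x_1, k_i(x_2) = q⁻¹x_2, k_j(x_1) = qx_1, k_j(x_2) = q⁻¹x_2, e_i(x_1) = 1, e_j(x_2) = x_1, f_i(x_1) = −qx_1², f_i(x_2) = −qx_1x_2, f_j(x_1) = x_2; (III) k_i(x_1) = qx_1, k_i(x_2) = q²x_2, k_j(x_1) = qx_1, k_j(x_2) = q⁻¹x_2, e_i(x_1) = −qx_1x_2, e_i(x_2) = −qx_2², e_j(x_2) = x_1, f_i(x_2) = 1, f_j(x_1) = x_2;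 (IV) k_i(x_1) = q⁻²x_1, k_i(x_2) = q⁻¹x_2, k_j(x_1) = qx_1, k_j(x_2) = q²x_2, e_i(x_1) = 1, e_j(x_1) = −qx_1x_2, e_j(x_2) = −qx_2², f_i(x_1) = −qx_1², f_i(x_2) = −qx_1x_2, f_j(x_2) = 1. Moreover, no structure of one of the four kinds (I)–(IV) is isomorphic to a structure of a different kind. -/
noncomputable section

open scoped BigOperators

/-- The defining relations of the quantum `n`-space `A_q(n)`:
`x_i x_j = q • (x_j x_i)` for `i > j`. -/
inductive QRel (q : ℂ) (n : ℕ) : FreeAlgebra ℂ (Fin n) → FreeAlgebra ℂ (Fin n) → Prop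
  | rel (i j : Fin n) (h : j < i) :
      QRel q n (FreeAlgebra.ι ℂ i * FreeAlgebra.ι ℂ j)
        (q • (FreeAlgebra.ι ℂ j * FreeAlgebra.ι ℂ i))

/-- The quantum `n`-space `A_q(n)`. -/
abbrev QSpace (q : ℂ) (n : ℕ) : Type := RingQuot (QRel q n)

/-- The generator `x_i` of the quantum `n`-space. -/
def Xg (q : ℂ) (n : ℕ) (i : Fin n) : QSpace q n :=
  RingQuot.mkAlgHom ℂ (QRel q n) (FreeAlgebra.ι ℂ i)

/-- The Cartan matrix of `sl(m+1)`: `a_{ii} = 2`, `a_{ij} = -1` if `|i-j| = 1`,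
`a_{ij} = 0` if `|i-j| > 1`. -/
def cartan (m : ℕ) (i j : Fin m) : ℤ :=
  if i = j then 2 else if ((i : ℤ) - (j : ℤ)).natAbs = 1 then -1 else 0

/-- A module-algebra structure of `U_q(sl(m+1))` on a unital `ℂ`-algebra `A`:
`ℂ`-linear maps `k_i` (unital algebra automorphisms with two-sided inverses `(k i).symm`),
`e_i`, `f_i` for `1 ≤ i ≤ m`, satisfying the twisted Leibniz rules and the defining
operator relations of `U_q(sl(m+1))`. -/
structure UqslMA (q : ℂ) (m : ℕ) (A : Type) [Ring A] [Algebra ℂ A] where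
  k : Fin m → (A ≃ₐ[ℂ] A)
  e : Fin m → (A →ₗ[ℂ] A)
  f : Fin m → (A →ₗ[ℂ] A)
  e_mul : ∀ (i : Fin m) (a b : A), e i (a * b) = a * e i b + e i a * k i b
  f_mul : ∀ (i : Fin m) (a b : A), f i (a * b) = (k i).symm a * f i b + f i a * b
  e_one : ∀ i : Fin m, e i 1 = 0
  f_one : ∀ i : Fin m, f i 1 = 0
  k_comm : ∀ (i j : Fin m) (a : A), k i (k j a) = k j (k i a)
  ke : ∀ (i j : Fin m) (a : A), k i (e j ((k i).symm a)) = q ^ cartan m i j • e j a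
  kf : ∀ (i j : Fin m) (a : A), k i (f j ((k i).symm a)) = q ^ (-cartan m i j) • f j a
  ef : ∀ (i j : Fin m) (a : A),
      e i (f j a) - f j (e i a) =
        if i = j then (q - q⁻¹)⁻¹ • (k i a - (k i).symm a) else 0
  ee_comm : ∀ i j : Fin m, cartan m i j = 0 → ∀ a : A, e i (e j a) = e j (e i a)
  ff_comm : ∀ i j : Fin m, cartan m i j = 0 → ∀ a : A, f i (f j a) = f j (f i a)
  serre_e : ∀ i j : Fin m, cartan m i j = -1 → ∀ a : A,
      e i (e i (e j a)) - (q + q⁻¹) • e i (e j (e i a)) + e j (e i (e i a)) = 0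
  serre_f : ∀ i j : Fin m, cartan m i j = -1 → ∀ a : A,
      f i (f i (f j a)) - (q + q⁻¹) • f i (f j (f i a)) + f j (f i (f i a)) = 0

/-- Isomorphism of module-algebra structures: an algebra automorphism `ψ` of `A` with
`ψ ∘ π₁(h) ∘ ψ⁻¹ = π₂(h)` for every generator `h ∈ {k_i^{±1}, e_i, f_i}`. -/
def UqslMA.Iso {q : ℂ} {m : ℕ} {A : Type} [Ring A] [Algebra ℂ A]
    (π₁ π₂ : UqslMA q m A) : Prop :=
  ∃ ψ : A ≃ₐ[ℂ] A,
    (∀ (i : Fin m) (a : A), ψ (π₁.k i (ψ.symm a)) = π₂.k i a) ∧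
    (∀ (i : Fin m) (a : A), ψ ((π₁.k i).symm (ψ.symm a)) = (π₂.k i).symm a) ∧
    (∀ (i : Fin m) (a : A), ψ (π₁.e i (ψ.symm a)) = π₂.e i a) ∧
    (∀ (i : Fin m) (a : A), ψ (π₁.f i (ψ.symm a)) = π₂.f i a)

/-- The generator `x_1` of the quantum plane. -/
def P1 (q : ℂ) : QSpace q 2 := Xg q 2 0
/-- The generator `x_2` of the quantum plane. -/
def P2 (q : ℂ) : QSpace q 2 := Xg q 2 1

/-- Kind (I): both `k`'s act by signs, all `e`'s and `f`'s vanish on the generators. -/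
def KindI (q : ℂ) (π : UqslMA q 2 (QSpace q 2)) : Prop :=
  ∃ i j : Fin 2, i ≠ j ∧ ∃ ε₁ ε₂ δ₁ δ₂ : ℂ,
    (ε₁ = 1 ∨ ε₁ = -1) ∧ (ε₂ = 1 ∨ ε₂ = -1) ∧ (δ₁ = 1 ∨ δ₁ = -1) ∧ (δ₂ = 1 ∨ δ₂ = -1) ∧
    π.k i (P1 q) = ε₁ • P1 q ∧ π.k i (P2 q) = ε₂ • P2 q ∧
    π.k j (P1 q) = δ₁ • P1 q ∧ π.k j (P2 q) = δ₂ • P2 q ∧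
    π.e i (P1 q) = 0 ∧ π.e i (P2 q) = 0 ∧ π.e j (P1 q) = 0 ∧ π.e j (P2 q) = 0 ∧
    π.f i (P1 q) = 0 ∧ π.f i (P2 q) = 0 ∧ π.f j (P1 q) = 0 ∧ π.f j (P2 q) = 0

/-- Kind (II). -/
def KindII (q : ℂ) (π : UqslMA q 2 (QSpace q 2)) : Prop :=
  ∃ i j : Fin 2, i ≠ j ∧
    π.k i (P1 q) = (q ^ (-2 : ℤ)) • P1 q ∧ π.k i (P2 q) = q⁻¹ • P2 q ∧
    π.k j (P1 q) = q • P1 q ∧ π.k j (P2 q) = q⁻¹ • P2 q ∧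
    π.e i (P1 q) = 1 ∧ π.e i (P2 q) = 0 ∧
    π.e j (P1 q) = 0 ∧ π.e j (P2 q) = P1 q ∧
    π.f i (P1 q) = (-q) • (P1 q * P1 q) ∧ π.f i (P2 q) = (-q) • (P1 q * P2 q) ∧
    π.f j (P1 q) = P2 q ∧ π.f j (P2 q) = 0

/-- Kind (III). -/
def KindIII (q : ℂ) (π : UqslMA q 2 (QSpace q 2)) : Prop :=
  ∃ i j : Fin 2, i ≠ j ∧
    π.k i (P1 q) = q • P1 q ∧ π.k i (P2 q) = (q ^ (2 : ℕ)) • P2 q ∧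
    π.k j (P1 q) = q • P1 q ∧ π.k j (P2 q) = q⁻¹ • P2 q ∧
    π.e i (P1 q) = (-q) • (P1 q * P2 q) ∧ π.e i (P2 q) = (-q) • (P2 q * P2 q) ∧
    π.e j (P1 q) = 0 ∧ π.e j (P2 q) = P1 q ∧
    π.f i (P1 q) = 0 ∧ π.f i (P2 q) = 1 ∧
    π.f j (P1 q) = P2 q ∧ π.f j (P2 q) = 0

/-- Kind (IV). -/
def KindIV (q : ℂ) (π : UqslMA q 2 (QSpace q 2)) : Prop :=
  ∃ i j : Fin 2, i ≠ j ∧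
    π.k i (P1 q) = (q ^ (-2 : ℤ)) • P1 q ∧ π.k i (P2 q) = q⁻¹ • P2 q ∧
    π.k j (P1 q) = q • P1 q ∧ π.k j (P2 q) = (q ^ (2 : ℕ)) • P2 q ∧
    π.e i (P1 q) = 1 ∧ π.e i (P2 q) = 0 ∧
    π.e j (P1 q) = (-q) • (P1 q * P2 q) ∧ π.e j (P2 q) = (-q) • (P2 q * P2 q) ∧
    π.f i (P1 q) = (-q) • (P1 q * P1 q) ∧ π.f i (P2 q) = (-q) • (P1 q * P2 q) ∧
    π.f j (P1 q) = 0 ∧ π.f j (P2 q) = 1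

/-- The four kinds of `U_q(sl(3))`-module-algebra structures on the quantum plane. -/
def KindOf (q : ℂ) : Fin 4 → UqslMA q 2 (QSpace q 2) → Prop
  | 0 => KindI q
  | 1 => KindII q
  | 2 => KindIII q
  | 3 => KindIV q

namespace QPlane

/-- The commutation relation of the quantum plane. -/
theorem P2_mul_P1 (q : ℂ) : P2 q * P1 q = q • (P1 q * P2 q) := by
  unfold P1 P2 Xg
  rw [← map_mul, ← map_mul, ← map_smul]
  exact RingQuot.mkAlgHom_rel ℂ (QRel.rel 1 0 (by decide))

/-- The universal property of the quantum plane. -/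
def lift {q : ℂ} {B : Type*} [Ring B] [Algebra ℂ B] (u v : B) (h : v * u = q • (u * v)) :
    QSpace q 2 →ₐ[ℂ] B :=
  RingQuot.liftAlgHom ℂ ⟨FreeAlgebra.lift ℂ ![u, v], by
    rintro _ _ ⟨i, j, hij⟩
    have hi : i = 1 := by omega
    have hj : j = 0 := by omega
    subst hi hj
    simpa using h⟩

section lift

variable {q : ℂ} {B : Type*} [Ring B] [Algebra ℂ B] (u v : B) (h : v * u = q • (u * v))

@[simp] theorem lift_P1 : lift u v h (P1 q) = u := by
  simp [lift, P1, Xg]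

@[simp] theorem lift_P2 : lift u v h (P2 q) = v := by
  simp [lift, P2, Xg]

end lift

theorem algHom_ext {q : ℂ} {B : Type*} [Ring B] [Algebra ℂ B] {φ ψ : QSpace q 2 →ₐ[ℂ] B}
    (h₁ : φ (P1 q) = ψ (P1 q)) (h₂ : φ (P2 q) = ψ (P2 q)) : φ = ψ := by
  apply RingQuot.ringQuot_ext'
  apply FreeAlgebra.hom_ext
  funext i
  fin_cases i
  · exact h₁
  · exact h₂

theorem adjoin_eq_top (q : ℂ) : Algebra.adjoin ℂ {P1 q, P2 q} = ⊤ := by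
  set S := Algebra.adjoin ℂ {P1 q, P2 q}
  have h₁ : P1 q ∈ S := Algebra.subset_adjoin (by simp)
  have h₂ : P2 q ∈ S := Algebra.subset_adjoin (by simp)
  let φ : QSpace q 2 →ₐ[ℂ] S := lift ⟨P1 q, h₁⟩ ⟨P2 q, h₂⟩ (Subtype.ext (P2_mul_P1 q))
  have hφ : S.val.comp φ = AlgHom.id ℂ _ := algHom_ext (by simp [φ]) (by simp [φ])
  refine eq_top_iff.2 fun u _ => ?_
  have := (φ u).2
  rwa [show ((φ u : S) : QSpace q 2) = u from DFunLike.congr_fun hφ u] at this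

/-- A property that holds for scalars and generators and is stable under sums and products
holds on the whole quantum plane. -/
theorem induction {q : ℂ} {C : QSpace q 2 → Prop} (hs : ∀ r : ℂ, C (algebraMap ℂ _ r))
    (h₁ : C (P1 q)) (h₂ : C (P2 q)) (ha : ∀ u v, C u → C v → C (u + v))
    (hm : ∀ u v, C u → C v → C (u * v)) (u : QSpace q 2) : C u := by
  have hu : u ∈ Algebra.adjoin ℂ {P1 q, P2 q} := by simp [adjoin_eq_top]
  induction hu using Algebra.adjoin_induction with
  | mem x hx => rcases hx with rfl | rfl <;> assumption
  | algebraMap r => exact hs r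
  | add x y _ _ hx hy => exact ha x y hx hy
  | mul x y _ _ hx hy => exact hm x y hx hy

/-- The ordered monomial `x₁ ^ a * x₂ ^ b`. -/
def mono (q : ℂ) (p : ℕ × ℕ) : QSpace q 2 := P1 q ^ p.1 * P2 q ^ p.2

theorem P2_mul_P1_pow (q : ℂ) (a : ℕ) : P2 q * P1 q ^ a = q ^ a • (P1 q ^ a * P2 q) := by
  induction a with
  | zero => simp
  | succ a ih =>
    rw [pow_succ, ← mul_assoc, ih, smul_mul_assoc, mul_assoc, P2_mul_P1, mul_smul_comm, smul_smul,
      ← mul_assoc, ← pow_succ]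

theorem P2_pow_mul_P1_pow (q : ℂ) (a b : ℕ) :
    P2 q ^ b * P1 q ^ a = q ^ (b * a) • (P1 q ^ a * P2 q ^ b) := by
  induction b with
  | zero => simp
  | succ b ih =>
    rw [pow_succ', mul_assoc, ih, mul_smul_comm, ← mul_assoc, P2_mul_P1_pow, smul_mul_assoc,
      smul_smul, mul_assoc, ← pow_add, Nat.succ_mul]

theorem mono_mul (q : ℂ) (p r : ℕ × ℕ) :
    mono q p * mono q r = q ^ (p.2 * r.1) • mono q (p + r) := by
  simp only [mono, Prod.fst_add, Prod.snd_add, pow_add]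
  rw [mul_assoc, ← mul_assoc (P2 q ^ p.2), P2_pow_mul_P1_pow]
  simp only [smul_mul_assoc, mul_smul_comm, mul_assoc]

/-- Left multiplication by `x₁` in the basis of ordered monomials. -/
def opP1 : (ℕ × ℕ →₀ ℂ) →ₗ[ℂ] (ℕ × ℕ →₀ ℂ) :=
  Finsupp.linearCombination ℂ fun p => Finsupp.single (p.1 + 1, p.2) 1

/-- Left multiplication by `x₂` in the basis of ordered monomials. -/
def opP2 (q : ℂ) : (ℕ × ℕ →₀ ℂ) →ₗ[ℂ] (ℕ × ℕ →₀ ℂ) :=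
  Finsupp.linearCombination ℂ fun p => Finsupp.single (p.1, p.2 + 1) (q ^ p.1)

/-- The action of the quantum plane on the span of the ordered monomials. -/
def rep (q : ℂ) : QSpace q 2 →ₐ[ℂ] Module.End ℂ (ℕ × ℕ →₀ ℂ) :=
  lift opP1 (opP2 q) <| by
    refine Finsupp.lhom_ext fun p c => ?_
    simp only [opP1, opP2, Module.End.mul_apply, Finsupp.linearCombination_single,
      Finsupp.smul_single, smul_eq_mul, mul_one, LinearMap.smul_apply, pow_succ]
    congr 1
    ring

/-- Coordinates with respect to the ordered monomials. -/
def coordMap (q : ℂ) : QSpace q 2 →ₗ[ℂ] (ℕ × ℕ →₀ ℂ) :=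
  LinearMap.applyₗ (Finsupp.single 0 1) ∘ₗ (rep q).toLinearMap

theorem coordMap_mono (q : ℂ) (p : ℕ × ℕ) : coordMap q (mono q p) = Finsupp.single p 1 := by
  obtain ⟨a, b⟩ := p
  have hb : (opP2 q ^ b) (Finsupp.single 0 1) = Finsupp.single (0, b) 1 := by
    induction b with
    | zero => simp; rfl
    | succ b ih => rw [pow_succ', Module.End.mul_apply, ih]; simp [opP2]
  have ha : (opP1 ^ a) (Finsupp.single (0, b) 1) = Finsupp.single (a, b) 1 := by
    induction a with
    | zero => simp
    | succ a ih => rw [pow_succ', Module.End.mul_apply, ih]; simp [opP1]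
  simp [coordMap, rep, mono, hb, ha]

theorem linearCombination_rep (q : ℂ) (u : QSpace q 2) (v : ℕ × ℕ →₀ ℂ) :
    Finsupp.linearCombination ℂ (mono q) (rep q u v)
      = u * Finsupp.linearCombination ℂ (mono q) v := by
  induction u using induction generalizing v with
  | hs r => simp [Algebra.algebraMap_eq_smul_one]
  | h₁ =>
    induction v using Finsupp.induction_linear with
    | zero => simp
    | add v w hv hw => simp [mul_add, hv, hw]
    | single p c => simp [rep, opP1, mono, pow_succ', mul_assoc]
  | h₂ =>
    induction v using Finsupp.induction_linear with
    | zero => simp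
    | add v w hv hw => simp [mul_add, hv, hw]
    | single p c =>
      simp [rep, opP2, mono, pow_succ', ← mul_assoc, P2_mul_P1_pow, smul_smul, -Finsupp.single_mul]
  | ha u w hu hw => simp [add_mul, hu, hw]
  | hm u w hu hw => simp [mul_assoc, hu, hw]

/-- The ordered monomials form a basis of the quantum plane. -/
def basis (q : ℂ) : Module.Basis (ℕ × ℕ) ℂ (QSpace q 2) :=
  .ofRepr <| LinearEquiv.ofLinearMap (coordMap q) (Finsupp.linearCombination ℂ (mono q))
    (Finsupp.lhom_ext fun p c => by simp [coordMap_mono])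
    (LinearMap.ext fun u => by
      have := linearCombination_rep q u (Finsupp.single 0 1)
      simpa [coordMap, mono] using this)

@[simp] theorem basis_apply (q : ℂ) (p : ℕ × ℕ) : basis q p = mono q p := by
  simp [basis]

/-- The coefficient of an ordered monomial. -/
def coef (q : ℂ) (p : ℕ × ℕ) : QSpace q 2 →ₗ[ℂ] ℂ := (basis q).coord p

theorem coef_mono (q : ℂ) (p r : ℕ × ℕ) : coef q p (mono q r) = if r = p then 1 else 0 := by
  rw [coef, ← basis_apply, Module.Basis.coord_apply, Module.Basis.repr_self,
    Finsupp.single_apply]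

theorem ext_coef {q : ℂ} {u v : QSpace q 2} (h : ∀ p, coef q p u = coef q p v) : u = v :=
  (basis q).ext_elem h

theorem eq_smul_mono {q : ℂ} {u : QSpace q 2} (p : ℕ × ℕ)
    (h : ∀ r, coef q r u ≠ 0 → r = p) : u = coef q p u • mono q p := by
  refine ext_coef fun r => ?_
  rw [map_smul, coef_mono, smul_eq_mul]
  split_ifs with hr
  · rw [hr, mul_one]
  · by_contra hne
    exact hr (h r (by simpa using hne)).symm

theorem linearMap_ext {q : ℂ} {M : Type*} [AddCommMonoid M] [Module ℂ M]
    {g g' : QSpace q 2 →ₗ[ℂ] M} (h : ∀ p, g (mono q p) = g' (mono q p)) : g = g' :=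
  (basis q).ext fun p => by simpa using h p

open Polynomial in
/-- Restriction to the axis `x₂ = 0`. -/
def resP1 (q : ℂ) : QSpace q 2 →ₐ[ℂ] ℂ[X] := lift X 0 (by simp)

open Polynomial in
/-- Restriction to the axis `x₁ = 0`. -/
def resP2 (q : ℂ) : QSpace q 2 →ₐ[ℂ] ℂ[X] := lift 0 X (by simp)

@[simp] theorem resP1_P1 (q : ℂ) : resP1 q (P1 q) = Polynomial.X := by simp [resP1]
@[simp] theorem resP1_P2 (q : ℂ) : resP1 q (P2 q) = 0 := by simp [resP1]
@[simp] theorem resP2_P1 (q : ℂ) : resP2 q (P1 q) = 0 := by simp [resP2]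
@[simp] theorem resP2_P2 (q : ℂ) : resP2 q (P2 q) = Polynomial.X := by simp [resP2]

theorem coeff_resP1 (q : ℂ) (a : ℕ) (u : QSpace q 2) :
    (resP1 q u).coeff a = coef q (a, 0) u := by
  suffices h : Polynomial.lcoeff ℂ a ∘ₗ (resP1 q).toLinearMap = coef q (a, 0) from
    DFunLike.congr_fun h u
  refine linearMap_ext fun ⟨c, d⟩ => ?_
  rw [coef_mono]
  cases d <;> simp [mono, Polynomial.coeff_X_pow, eq_comm]

theorem coeff_resP2 (q : ℂ) (b : ℕ) (u : QSpace q 2) :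
    (resP2 q u).coeff b = coef q (0, b) u := by
  suffices h : Polynomial.lcoeff ℂ b ∘ₗ (resP2 q).toLinearMap = coef q (0, b) from
    DFunLike.congr_fun h u
  refine linearMap_ext fun ⟨c, d⟩ => ?_
  rw [coef_mono]
  cases c <;> simp [mono, Polynomial.coeff_X_pow, eq_comm]

theorem coef_P1_mul (q : ℂ) (a b : ℕ) (u : QSpace q 2) :
    coef q (a + 1, b) (P1 q * u) = coef q (a, b) u := by
  suffices h : coef q (a + 1, b) ∘ₗ LinearMap.mulLeft ℂ (P1 q) = coef q (a, b) from
    DFunLike.congr_fun h u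
  refine linearMap_ext fun p => ?_
  have : P1 q * mono q p = mono q (p.1 + 1, p.2) := by simp [mono, pow_succ', mul_assoc]
  simp [this, coef_mono, Prod.ext_iff]

theorem coef_P2_mul (q : ℂ) (a b : ℕ) (u : QSpace q 2) :
    coef q (a, b + 1) (P2 q * u) = q ^ a * coef q (a, b) u := by
  suffices h : coef q (a, b + 1) ∘ₗ LinearMap.mulLeft ℂ (P2 q) = q ^ a • coef q (a, b) from
    DFunLike.congr_fun h u
  refine linearMap_ext fun p => ?_
  have : P2 q * mono q p = q ^ p.1 • mono q (p.1, p.2 + 1) := by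
    simp [mono, pow_succ', ← mul_assoc, P2_mul_P1_pow]
  simp only [LinearMap.comp_apply, LinearMap.mulLeft_apply, this, map_smul, coef_mono,
    Prod.ext_iff, smul_eq_mul, LinearMap.smul_apply, Nat.add_right_cancel_iff]
  split_ifs with hp
  · rw [hp.1]
  · simp

theorem P1_mul_cancel {q : ℂ} {u v : QSpace q 2} (h : P1 q * u = P1 q * v) : u = v :=
  ext_coef fun ⟨a, b⟩ => by rw [← coef_P1_mul, h, coef_P1_mul]

theorem P2_mul_cancel {q : ℂ} (hq : q ≠ 0) {u v : QSpace q 2} (h : P2 q * u = P2 q * v) :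
    u = v :=
  ext_coef fun ⟨a, b⟩ => mul_left_cancel₀ (pow_ne_zero a hq) <| by
    rw [← coef_P2_mul, h, coef_P2_mul]

theorem mem_of_mono_mem {q : ℂ} {S : Submodule ℂ (QSpace q 2)} (h : ∀ p, mono q p ∈ S)
    (u : QSpace q 2) : u ∈ S := by
  have : Submodule.span ℂ (Set.range (basis q)) ≤ S :=
    Submodule.span_le.2 (by rintro _ ⟨p, rfl⟩; simpa using h p)
  exact this (by simp)

theorem exists_eq_P2_mul {q : ℂ} (hq : q ≠ 0) {u : QSpace q 2} (h : resP1 q u = 0) :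
    ∃ w, u = P2 q * w := by
  let g : Polynomial ℂ × QSpace q 2 →ₗ[ℂ] QSpace q 2 :=
    (Polynomial.aeval (P1 q)).toLinearMap.coprod (LinearMap.mulLeft ℂ (P2 q))
  obtain ⟨⟨P, w⟩, hw⟩ : u ∈ LinearMap.range g := mem_of_mono_mem (fun ⟨a, b⟩ => by
    cases b with
    | zero => exact ⟨(Polynomial.X ^ a, 0), by simp [g, mono]⟩
    | succ b =>
      refine ⟨(0, (q ^ a)⁻¹ • mono q (a, b)), ?_⟩
      simp [g, mono, ← mul_assoc, P2_mul_P1_pow, pow_succ', smul_smul, pow_ne_zero a hq]) u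
  have hP : resP1 q (Polynomial.aeval (P1 q) P) = P := by
    rw [← Polynomial.aeval_algHom_apply, resP1_P1, Polynomial.aeval_X_left_apply]
  have hP0 : P = 0 := by
    rw [← hw] at h
    simpa [g, hP] using h
  exact ⟨w, by simp [← hw, g, hP0]⟩

theorem exists_eq_P1_mul {q : ℂ} {u : QSpace q 2} (h : resP2 q u = 0) :
    ∃ w, u = P1 q * w := by
  let g : Polynomial ℂ × QSpace q 2 →ₗ[ℂ] QSpace q 2 :=
    (Polynomial.aeval (P2 q)).toLinearMap.coprod (LinearMap.mulLeft ℂ (P1 q))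
  obtain ⟨⟨P, w⟩, hw⟩ : u ∈ LinearMap.range g := mem_of_mono_mem (fun ⟨a, b⟩ => by
    cases a with
    | zero => exact ⟨(Polynomial.X ^ b, 0), by simp [g, mono]⟩
    | succ a => exact ⟨(0, mono q (a, b)), by simp [g, mono, ← mul_assoc, pow_succ']⟩) u
  have hP : resP2 q (Polynomial.aeval (P2 q) P) = P := by
    rw [← Polynomial.aeval_algHom_apply, resP2_P2, Polynomial.aeval_X_left_apply]
  have hP0 : P = 0 := by
    rw [← hw] at h
    simpa [g, hP] using h
  exact ⟨w, by simp [← hw, g, hP0]⟩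

theorem eq_sum_coef (q : ℂ) (u : QSpace q 2) :
    u = ∑ p ∈ ((basis q).repr u).support, coef q p u • mono q p := by
  conv_lhs => rw [← (basis q).linearCombination_repr u, Finsupp.linearCombination_apply]
  simp [Finsupp.sum, coef]

/-- Coefficient of a product at the sum of the lexicographically largest exponents. -/
theorem coef_mul_of_max {q : ℂ} {u w : QSpace q 2} {M N : ℕ × ℕ}
    (hM : ∀ p, coef q p u ≠ 0 → toLex p ≤ toLex M) (hN : ∀ p, coef q p w ≠ 0 → toLex p ≤ toLex N) :
    coef q (M + N) (u * w) = q ^ (M.2 * N.1) * (coef q M u * coef q N w) := by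
  have key : ∀ p r, p + r = M + N → coef q p u ≠ 0 → coef q r w ≠ 0 → p = M ∧ r = N := by
    intro p r h hp hr
    have h' : toLex p + toLex r = toLex M + toLex N := congrArg toLex h
    have := (add_eq_add_iff_eq_and_eq (hM p hp) (hN r hr)).1 h'
    simpa using this
  conv_lhs => rw [eq_sum_coef q u, eq_sum_coef q w]
  rw [Finset.sum_mul_sum, map_sum]
  simp only [map_sum, smul_mul_smul_comm, mono_mul, map_smul, coef_mono, smul_eq_mul]
  rw [Finset.sum_eq_single M, Finset.sum_eq_single N]
  · simp [mul_comm]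
  · intro r _ hr
    by_cases h0 : coef q M u * coef q r w = 0
    · simp [h0]
    · rw [if_neg fun h => hr (key _ _ h (left_ne_zero_of_mul h0) (right_ne_zero_of_mul h0)).2]
      simp
  · intro h
    simp [show coef q N w = 0 by simpa [coef] using h]
  · intro p _ hp
    refine Finset.sum_eq_zero fun r _ => ?_
    by_cases h0 : coef q p u * coef q r w = 0
    · simp [h0]
    · rw [if_neg fun h => hp (key _ _ h (left_ne_zero_of_mul h0) (right_ne_zero_of_mul h0)).1]
      simp
  · intro h
    simp [show coef q M u = 0 by simpa [coef] using h]

theorem exists_max {q : ℂ} {u : QSpace q 2} (hu : u ≠ 0) :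
    ∃ M, coef q M u ≠ 0 ∧ ∀ p, coef q p u ≠ 0 → toLex p ≤ toLex M := by
  have hne : ((basis q).repr u).support.Nonempty := by simpa using hu
  obtain ⟨M, hM, hmax⟩ := Finset.exists_max_image _ (fun p : ℕ × ℕ => toLex p) hne
  exact ⟨M, by simpa [coef] using hM, fun p hp => hmax p (by simpa [coef] using hp)⟩

theorem one_eq_mono (q : ℂ) : (1 : QSpace q 2) = mono q 0 := by simp [mono]

instance (q : ℂ) : Nontrivial (QSpace q 2) :=
  (resP1 q).toRingHom.domain_nontrivial

/-- Invertible elements of the quantum plane are scalars. -/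
theorem eq_smul_one_of_mul_eq_one {q : ℂ} (hq : q ≠ 0) {u w : QSpace q 2} (h : u * w = 1) :
    ∃ c : ℂ, w = c • 1 := by
  obtain ⟨M, hM, hM'⟩ := exists_max (left_ne_zero_of_mul (h ▸ one_ne_zero))
  obtain ⟨N, hN, hN'⟩ := exists_max (right_ne_zero_of_mul (h ▸ one_ne_zero))
  have hMN := coef_mul_of_max hM' hN'
  rw [h, one_eq_mono, coef_mono] at hMN
  have h0 : (0 : ℕ × ℕ) = M + N := by
    by_contra hne
    rw [if_neg hne] at hMN
    exact mul_ne_zero (pow_ne_zero _ hq) (mul_ne_zero hM hN) hMN.symm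
  have hN0 : N = 0 := by
    simp only [Prod.ext_iff, Prod.fst_add, Prod.snd_add, Prod.fst_zero, Prod.snd_zero] at h0 ⊢
    omega
  refine ⟨_, one_eq_mono q ▸ eq_smul_mono 0 fun r hr => ?_⟩
  have := hN' r hr
  rw [hN0, Prod.Lex.toLex_le_toLex] at this
  simp only [Prod.ext_iff, Prod.fst_zero, Prod.snd_zero] at this ⊢
  omega

theorem P1_ne_zero (q : ℂ) : P1 q ≠ 0 := fun h =>
  Polynomial.X_ne_zero (by rw [← resP1_P1 q, h, map_zero])
theorem P2_ne_zero (q : ℂ) : P2 q ≠ 0 := fun h =>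
  Polynomial.X_ne_zero (by rw [← resP2_P2 q, h, map_zero])

section Automorphism

variable {q : ℂ}

theorem res_eq_zero_of_res_map_eq_zero (hq : q ≠ 0) (φ : QSpace q 2 ≃ₐ[ℂ] QSpace q 2)
    (hc : resP1 q (φ.symm (P2 q)) * resP1 q (φ.symm (P1 q)) = 0)
    (hc' : resP2 q (φ.symm (P2 q)) * resP2 q (φ.symm (P1 q)) = 0)
    {z : QSpace q 2} (h₁ : resP1 q (φ z) = 0) (h₂ : resP2 q (φ z) = 0) :
    resP1 q z = 0 ∧ resP2 q z = 0 := by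
  obtain ⟨w, hw⟩ := exists_eq_P2_mul hq h₁
  obtain ⟨w', rfl⟩ : ∃ w', w = P1 q * w' := exists_eq_P1_mul <| by
    simpa [hw, Polynomial.X_ne_zero] using h₂
  have hz : z = φ.symm (P2 q) * φ.symm (P1 q) * φ.symm w' := by
    rw [← map_mul, ← map_mul, mul_assoc, ← hw, AlgEquiv.symm_apply_apply]
  constructor
  · rw [hz, map_mul, map_mul, hc, zero_mul]
  · rw [hz, map_mul, map_mul, hc', zero_mul]

theorem mul_eq_zero_of_algHom_comm (hq : q ≠ 1) {B : Type*} [CommRing B] [Algebra ℂ B]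
    (φ : QSpace q 2 →ₐ[ℂ] B) : φ (P2 q) * φ (P1 q) = 0 := by
  have h := congrArg φ (P2_mul_P1 q)
  rw [map_mul, map_smul, map_mul, mul_comm (φ (P1 q))] at h
  have : (1 - q) • (φ (P2 q) * φ (P1 q)) = 0 := by rw [sub_smul, one_smul, ← h, sub_self]
  exact (smul_eq_zero_iff_right (sub_ne_zero.2 hq.symm)).1 this

/-- An automorphism preserves or exchanges the ideals generated by `x₁` and `x₂`. -/
theorem map_dvd_or (hq : q ≠ 0) (hq1 : q ≠ 1) (φ : QSpace q 2 ≃ₐ[ℂ] QSpace q 2) :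
    ((∃ u, φ (P1 q) = P1 q * u) ∧ ∃ v, φ (P2 q) = P2 q * v) ∨
    ((∃ u, φ (P1 q) = P2 q * u) ∧ ∃ v, φ (P2 q) = P1 q * v) := by
  have h₁ := mul_eq_zero_of_algHom_comm hq1 ((resP1 q).comp φ.toAlgHom)
  have h₂ := mul_eq_zero_of_algHom_comm hq1 ((resP2 q).comp φ.toAlgHom)
  have key {z : QSpace q 2} := res_eq_zero_of_res_map_eq_zero hq φ (z := z)
    (mul_eq_zero_of_algHom_comm hq1 ((resP1 q).comp φ.symm.toAlgHom))
    (mul_eq_zero_of_algHom_comm hq1 ((resP2 q).comp φ.symm.toAlgHom))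
  rcases mul_eq_zero.1 h₁ with h₁ | h₁ <;> rcases mul_eq_zero.1 h₂ with h₂ | h₂
  · exact absurd (key h₁ h₂).2 (by simp [Polynomial.X_ne_zero])
  · exact .inl ⟨exists_eq_P1_mul h₂, exists_eq_P2_mul hq h₁⟩
  · exact .inr ⟨exists_eq_P2_mul hq h₁, exists_eq_P1_mul h₂⟩
  · exact absurd (key h₁ h₂).1 (by simp [Polynomial.X_ne_zero])

theorem map_eq_smul_of_dvd (hq : q ≠ 0) (φ : QSpace q 2 ≃ₐ[ℂ] QSpace q 2)
    {s t u w : QSpace q 2} (hs0 : s ≠ 0) (hs : ∀ {u v}, s * u = s * v → u = v)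
    (h : φ s = t * u) (h' : φ.symm t = s * w) : ∃ c : ℂ, c ≠ 0 ∧ φ s = c • t := by
  have hw : w * φ.symm u = 1 := hs <| by
    rw [← mul_assoc, ← h', ← map_mul, ← h, AlgEquiv.symm_apply_apply, mul_one]
  obtain ⟨c, hc⟩ := eq_smul_one_of_mul_eq_one hq hw
  have hu : u = c • 1 := by rw [← φ.apply_symm_apply u, hc, map_smul, map_one]
  refine ⟨c, ?_, by rw [h, hu, mul_smul_comm, mul_one]⟩
  rintro rfl
  rw [hu, zero_smul, mul_zero] at h
  exact hs0 (φ.injective (by rw [h, map_zero]))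

theorem P1_ne_P2_mul (u : QSpace q 2) : P1 q ≠ P2 q * u := fun h => by
  simpa [Polynomial.X_ne_zero] using congrArg (resP1 q) h

/-- Every automorphism of the quantum plane is diagonal. -/
theorem automorphism_diagonal (hq : q ≠ 0) (hq2 : q ^ 2 ≠ 1) (φ : QSpace q 2 ≃ₐ[ℂ] QSpace q 2) :
    ∃ c d : ℂ, c ≠ 0 ∧ d ≠ 0 ∧ φ (P1 q) = c • P1 q ∧ φ (P2 q) = d • P2 q := by
  have hq1 : q ≠ 1 := by rintro rfl; simp at hq2
  obtain ⟨⟨u, hu⟩, v, hv⟩ | ⟨⟨u, hu⟩, v, hv⟩ := map_dvd_or hq hq1 φ <;>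
    obtain ⟨⟨u', hu'⟩, v', hv'⟩ | ⟨⟨u', hu'⟩, v', hv'⟩ := map_dvd_or hq hq1 φ.symm
  · obtain ⟨c, hc, h⟩ := map_eq_smul_of_dvd hq φ (P1_ne_zero q) P1_mul_cancel hu hu'
    obtain ⟨d, hd, h'⟩ := map_eq_smul_of_dvd hq φ (P2_ne_zero q) (P2_mul_cancel hq) hv hv'
    exact ⟨c, d, hc, hd, h, h'⟩
  · refine absurd ?_ (P1_ne_P2_mul (v * φ u'))
    rw [← mul_assoc, ← hv, ← map_mul, ← hu', AlgEquiv.apply_symm_apply]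
  · refine absurd ?_ (P1_ne_P2_mul (v' * φ.symm u))
    rw [← mul_assoc, ← hv', ← map_mul, ← hu, AlgEquiv.symm_apply_apply]
  · obtain ⟨c, hc, h⟩ := map_eq_smul_of_dvd hq φ (P1_ne_zero q) P1_mul_cancel hu hv'
    obtain ⟨d, hd, h'⟩ := map_eq_smul_of_dvd hq φ (P2_ne_zero q) (P2_mul_cancel hq) hv hu'
    have hcomm := congrArg φ (P2_mul_P1 q)
    rw [map_mul, map_smul, map_mul, h, h', smul_mul_smul_comm, smul_mul_smul_comm, P2_mul_P1,
      show P1 q * P2 q = mono q (1, 1) by simp [mono]] at hcomm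
    have := congrArg (coef q (1, 1)) hcomm
    simp only [map_smul, coef_mono, if_true, smul_eq_mul, mul_one] at this
    refine absurd (mul_left_cancel₀ (mul_ne_zero hc hd) ?_) hq2
    linear_combination -this

end Automorphism

section Scale

variable {q : ℂ}

/-- The diagonal endomorphism `x₁ ↦ c x₁`, `x₂ ↦ d x₂`. -/
def scaleHom (q c d : ℂ) : QSpace q 2 →ₐ[ℂ] QSpace q 2 :=
  lift (c • P1 q) (d • P2 q) <| by
    rw [smul_mul_smul_comm, smul_mul_smul_comm, P2_mul_P1, smul_smul, smul_smul]
    ring_nf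

/-- The diagonal automorphism `x₁ ↦ c x₁`, `x₂ ↦ d x₂`. -/
def scale (q : ℂ) {c d : ℂ} (hc : c ≠ 0) (hd : d ≠ 0) : QSpace q 2 ≃ₐ[ℂ] QSpace q 2 :=
  AlgEquiv.ofAlgHom (scaleHom q c d) (scaleHom q c⁻¹ d⁻¹)
    (algHom_ext (by simp [scaleHom, smul_smul, hc]) (by simp [scaleHom, smul_smul, hd]))
    (algHom_ext (by simp [scaleHom, smul_smul, hc]) (by simp [scaleHom, smul_smul, hd]))

variable {c d : ℂ} (hc : c ≠ 0) (hd : d ≠ 0)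

@[simp] theorem scale_P1 : scale q hc hd (P1 q) = c • P1 q := by simp [scale, scaleHom]
@[simp] theorem scale_P2 : scale q hc hd (P2 q) = d • P2 q := by simp [scale, scaleHom]
@[simp] theorem scale_symm_P1 : (scale q hc hd).symm (P1 q) = c⁻¹ • P1 q := by
  simp [scale, scaleHom]
@[simp] theorem scale_symm_P2 : (scale q hc hd).symm (P2 q) = d⁻¹ • P2 q := by
  simp [scale, scaleHom]

end Scale

/-- Transport of a module-algebra structure along an algebra automorphism. -/
def transport {q : ℂ} {m : ℕ} {A : Type} [Ring A] [Algebra ℂ A] (π : UqslMA q m A)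
    (ψ : A ≃ₐ[ℂ] A) : UqslMA q m A where
  k i := (ψ.symm.trans (π.k i)).trans ψ
  e i := ψ.toLinearMap ∘ₗ π.e i ∘ₗ ψ.symm.toLinearMap
  f i := ψ.toLinearMap ∘ₗ π.f i ∘ₗ ψ.symm.toLinearMap
  e_mul i a b := by simp [π.e_mul]
  f_mul i a b := by simp [π.f_mul]
  e_one i := by simp [π.e_one]
  f_one i := by simp [π.f_one]
  k_comm i j a := by simp [π.k_comm i j]
  ke i j a := by simp [π.ke]
  kf i j a := by simp [π.kf]
  ef i j a := by
    have := congrArg ψ (π.ef i j (ψ.symm a))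
    split_ifs at this ⊢ <;> simpa using this
  ee_comm i j h a := by simp [π.ee_comm i j h]
  ff_comm i j h a := by simp [π.ff_comm i j h]
  serre_e i j h a := by simpa using congrArg ψ (π.serre_e i j h (ψ.symm a))
  serre_f i j h a := by simpa using congrArg ψ (π.serre_f i j h (ψ.symm a))

theorem iso_transport {q : ℂ} {m : ℕ} {A : Type} [Ring A] [Algebra ℂ A] (π : UqslMA q m A)
    (ψ : A ≃ₐ[ℂ] A) : π.Iso (transport π ψ) :=
  ⟨ψ, fun _ _ => rfl, fun _ _ => rfl, fun _ _ => rfl, fun _ _ => rfl⟩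

theorem cartan_self (i : Fin 2) : cartan 2 i i = 2 := by simp [cartan]

theorem cartan_of_ne {i j : Fin 2} (h : i ≠ j) : cartan 2 i j = -1 := by
  fin_cases i <;> fin_cases j <;> simp_all [cartan]

/-- The structure `π` acts diagonally on the generators through the weights `α` and `β`. -/
structure HasWeights {q : ℂ} (π : UqslMA q 2 (QSpace q 2)) (α β : Fin 2 → ℂ) : Prop where
  ne₁ : ∀ l, α l ≠ 0
  ne₂ : ∀ l, β l ≠ 0
  k_P1 : ∀ l, π.k l (P1 q) = α l • P1 q
  k_P2 : ∀ l, π.k l (P2 q) = β l • P2 q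

theorem exists_hasWeights {q : ℂ} (hq : q ≠ 0) (hq2 : q ^ 2 ≠ 1) (π : UqslMA q 2 (QSpace q 2)) :
    ∃ α β, HasWeights π α β := by
  choose α β h₁ h₂ h₃ h₄ using fun l => automorphism_diagonal hq hq2 (π.k l)
  exact ⟨α, β, h₁, h₂, h₃, h₄⟩

theorem coef_map_of_diagonal {q c d : ℂ} (φ : QSpace q 2 ≃ₐ[ℂ] QSpace q 2)
    (h₁ : φ (P1 q) = c • P1 q) (h₂ : φ (P2 q) = d • P2 q) (p : ℕ × ℕ) (u : QSpace q 2) :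
    coef q p (φ u) = c ^ p.1 * d ^ p.2 * coef q p u := by
  suffices h : coef q p ∘ₗ φ.toLinearMap = (c ^ p.1 * d ^ p.2) • coef q p from
    DFunLike.congr_fun h u
  refine linearMap_ext fun r => ?_
  have : φ (mono q r) = (c ^ r.1 * d ^ r.2) • mono q r := by
    simp [mono, h₁, h₂, smul_pow, smul_smul]
    rw [mul_comm]
  simp only [LinearMap.comp_apply, AlgEquiv.toLinearMap_apply, this, map_smul, coef_mono,
    LinearMap.smul_apply, smul_eq_mul]
  split_ifs with h
  · rw [h]
  · simp

/-- Elements whose constant and linear coefficients vanish. -/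
def Deep {q : ℂ} (u : QSpace q 2) : Prop :=
  coef q (0, 0) u = 0 ∧ coef q (1, 0) u = 0 ∧ coef q (0, 1) u = 0

theorem deep_iff {q : ℂ} {u : QSpace q 2} :
    Deep u ↔ Polynomial.X ^ 2 ∣ resP1 q u ∧ Polynomial.X ^ 2 ∣ resP2 q u := by
  simp only [Polynomial.X_pow_dvd_iff, coeff_resP1, coeff_resP2, Deep]
  constructor
  · rintro ⟨h₁, h₂, h₃⟩
    constructor <;> intro d hd <;> interval_cases d <;> assumption
  · rintro ⟨h₁, h₂⟩
    exact ⟨h₁ 0 (by norm_num), h₁ 1 (by norm_num), h₂ 1 (by norm_num)⟩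

theorem Deep.mul_left {q : ℂ} {u : QSpace q 2} (h : Deep u) (w : QSpace q 2) : Deep (w * u) := by
  rw [deep_iff] at h ⊢
  simpa using ⟨h.1.mul_left _, h.2.mul_left _⟩

theorem Deep.mul_right {q : ℂ} {u : QSpace q 2} (h : Deep u) (w : QSpace q 2) :
    Deep (u * w) := by
  rw [deep_iff] at h ⊢
  simpa using ⟨h.1.mul_right _, h.2.mul_right _⟩

theorem Deep.add {q : ℂ} {u w : QSpace q 2} (h : Deep u) (h' : Deep w) : Deep (u + w) := by
  simp_all [Deep]

theorem Deep.sub {q : ℂ} {u w : QSpace q 2} (h : Deep u) (h' : Deep w) : Deep (u - w) := by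
  simp_all [Deep]

theorem deep_zero (q : ℂ) : Deep (0 : QSpace q 2) := by simp [Deep]

section Structure

variable {q : ℂ} (π : UqslMA q 2 (QSpace q 2))

theorem deep_e {i : Fin 2} (h₁ : Deep (π.e i (P1 q))) (h₂ : Deep (π.e i (P2 q)))
    (u : QSpace q 2) : Deep (π.e i u) := by
  induction u using induction with
  | hs r => simpa [Algebra.algebraMap_eq_smul_one, π.e_one] using deep_zero q
  | h₁ => exact h₁
  | h₂ => exact h₂
  | ha u v hu hv => simpa using hu.add hv
  | hm u v hu hv => rw [π.e_mul]; exact (hv.mul_left _).add (hu.mul_right _)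

theorem deep_f {i : Fin 2} (h₁ : Deep (π.f i (P1 q))) (h₂ : Deep (π.f i (P2 q)))
    (u : QSpace q 2) : Deep (π.f i u) := by
  induction u using induction with
  | hs r => simpa [Algebra.algebraMap_eq_smul_one, π.f_one] using deep_zero q
  | h₁ => exact h₁
  | h₂ => exact h₂
  | ha u v hu hv => simpa using hu.add hv
  | hm u v hu hv => rw [π.f_mul]; exact (hv.mul_left _).add (hu.mul_right _)

theorem k_e (l i : Fin 2) (u : QSpace q 2) :
    π.k l (π.e i u) = q ^ cartan 2 l i • π.e i (π.k l u) := by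
  rw [← π.ke, AlgEquiv.symm_apply_apply]

theorem k_f (l i : Fin 2) (u : QSpace q 2) :
    π.k l (π.f i u) = q ^ (-cartan 2 l i) • π.f i (π.k l u) := by
  rw [← π.kf, AlgEquiv.symm_apply_apply]

variable {π} {α β : Fin 2 → ℂ} (hw : HasWeights π α β)
include hw

theorem HasWeights.k_symm_P1 (l : Fin 2) : (π.k l).symm (P1 q) = (α l)⁻¹ • P1 q := by
  rw [AlgEquiv.symm_apply_eq, map_smul, hw.k_P1, smul_smul, inv_mul_cancel₀ (hw.ne₁ l), one_smul]

theorem HasWeights.k_symm_P2 (l : Fin 2) : (π.k l).symm (P2 q) = (β l)⁻¹ • P2 q := by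
  rw [AlgEquiv.symm_apply_eq, map_smul, hw.k_P2, smul_smul, inv_mul_cancel₀ (hw.ne₂ l), one_smul]

theorem HasWeights.eq_of_coef_ne_zero {l : Fin 2} {u : QSpace q 2} {w : ℂ}
    (hu : π.k l u = w • u) {p : ℕ × ℕ} (hp : coef q p u ≠ 0) :
    α l ^ p.1 * β l ^ p.2 = w := by
  have := congrArg (coef q p) hu
  rw [coef_map_of_diagonal _ (hw.k_P1 l) (hw.k_P2 l), map_smul, smul_eq_mul] at this
  exact mul_right_cancel₀ hp this

theorem HasWeights.of_coef_e_P1 {i : Fin 2} {p : ℕ × ℕ} (hp : coef q p (π.e i (P1 q)) ≠ 0)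
    (l : Fin 2) : α l ^ p.1 * β l ^ p.2 = q ^ cartan 2 l i * α l :=
  hw.eq_of_coef_ne_zero (by rw [k_e, hw.k_P1, map_smul, smul_smul]) hp

theorem HasWeights.of_coef_e_P2 {i : Fin 2} {p : ℕ × ℕ} (hp : coef q p (π.e i (P2 q)) ≠ 0)
    (l : Fin 2) : α l ^ p.1 * β l ^ p.2 = q ^ cartan 2 l i * β l :=
  hw.eq_of_coef_ne_zero (by rw [k_e, hw.k_P2, map_smul, smul_smul]) hp

theorem HasWeights.of_coef_f_P1 {i : Fin 2} {p : ℕ × ℕ} (hp : coef q p (π.f i (P1 q)) ≠ 0)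
    (l : Fin 2) : α l ^ p.1 * β l ^ p.2 = q ^ (-cartan 2 l i) * α l :=
  hw.eq_of_coef_ne_zero (by rw [k_f, hw.k_P1, map_smul, smul_smul]) hp

theorem HasWeights.of_coef_f_P2 {i : Fin 2} {p : ℕ × ℕ} (hp : coef q p (π.f i (P2 q)) ≠ 0)
    (l : Fin 2) : α l ^ p.1 * β l ^ p.2 = q ^ (-cartan 2 l i) * β l :=
  hw.eq_of_coef_ne_zero (by rw [k_f, hw.k_P2, map_smul, smul_smul]) hp

theorem HasWeights.e_relation (i : Fin 2) :
    P2 q * π.e i (P1 q) + α i • (π.e i (P2 q) * P1 q)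
      = q • (P1 q * π.e i (P2 q)) + (q * β i) • (π.e i (P1 q) * P2 q) := by
  have h := congrArg (π.e i) (P2_mul_P1 q)
  simpa [π.e_mul, hw.k_P1, hw.k_P2, smul_smul] using h

theorem HasWeights.f_relation (i : Fin 2) :
    (β i)⁻¹ • (P2 q * π.f i (P1 q)) + π.f i (P2 q) * P1 q
      = (q * (α i)⁻¹) • (P1 q * π.f i (P2 q)) + q • (π.f i (P1 q) * P2 q) := by
  have h := congrArg (π.f i) (P2_mul_P1 q)
  simpa [π.f_mul, hw.k_symm_P1, hw.k_symm_P2, smul_smul] using h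

theorem HasWeights.of_coef_axis_e_P1 {i : Fin 2} {b : ℕ}
    (hb : coef q (0, b) (π.e i (P1 q)) ≠ 0) : q * β i = 1 := by
  have h := congrArg (coef q (0, b + 1)) (hw.e_relation i)
  simp only [← coeff_resP2] at h hb
  simp at h
  exact mul_right_cancel₀ hb (by rw [one_mul, ← h])

theorem HasWeights.of_coef_axis_e_P2 {i : Fin 2} {a : ℕ}
    (ha : coef q (a, 0) (π.e i (P2 q)) ≠ 0) : α i = q := by
  have h := congrArg (coef q (a + 1, 0)) (hw.e_relation i)
  simp only [← coeff_resP1] at h ha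
  simp at h
  tauto

theorem HasWeights.of_coef_axis_f_P1 {i : Fin 2} {b : ℕ}
    (hb : coef q (0, b) (π.f i (P1 q)) ≠ 0) : q * β i = 1 := by
  have h := congrArg (coef q (0, b + 1)) (hw.f_relation i)
  simp only [← coeff_resP2] at h hb
  simp at h
  have := h.resolve_right hb
  rw [← this, inv_mul_cancel₀ (hw.ne₂ i)]

theorem HasWeights.of_coef_axis_f_P2 {i : Fin 2} {a : ℕ}
    (ha : coef q (a, 0) (π.f i (P2 q)) ≠ 0) : α i = q := by
  have h := congrArg (coef q (a + 1, 0)) (hw.f_relation i)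
  simp only [← coeff_resP1] at h ha
  simp at h
  have h' : q * (α i)⁻¹ = 1 := mul_right_cancel₀ ha (by rw [one_mul, ← h])
  have := hw.ne₁ i
  field_simp at h'
  exact h'.symm

end Structure

theorem zpow_inj {q : ℂ} (hq : q ≠ 0) (hq' : ∀ N : ℕ, 0 < N → q ^ N ≠ 1) {a b : ℤ}
    (h : q ^ a = q ^ b) : a = b := by
  by_contra hne
  have h₁ : q ^ (a - b) = 1 := by rw [zpow_sub₀ hq, h, div_self (zpow_ne_zero b hq)]
  apply hq' (a - b).natAbs (by omega)
  rcases Int.natAbs_eq (a - b) with h₂ | h₂ <;> rw [h₂] at h₁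
  · exact_mod_cast h₁
  · rw [zpow_neg, inv_eq_one] at h₁
    exact_mod_cast h₁

section Weights

variable {q : ℂ} {π : UqslMA q 2 (QSpace q 2)} {α β : Fin 2 → ℂ}

theorem not_deep {u : QSpace q 2} (h : ¬ Deep u) :
    coef q (0, 0) u ≠ 0 ∨ coef q (1, 0) u ≠ 0 ∨ coef q (0, 1) u ≠ 0 := by
  simpa only [Deep, not_and_or] using h

theorem HasWeights.sq_eq_one_of_deep (hq2 : q ^ 2 ≠ 1) (hq : q ≠ 0) (hw : HasWeights π α β)
    {i : Fin 2} (h₁ : Deep (π.e i (P1 q))) (h₂ : Deep (π.e i (P2 q)))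
    (h₃ : Deep (π.f i (P1 q))) (h₄ : Deep (π.f i (P2 q))) : α i ^ 2 = 1 ∧ β i ^ 2 = 1 := by
  have hqq : (q - q⁻¹)⁻¹ ≠ 0 := by
    refine inv_ne_zero fun h => hq2 ?_
    field_simp at h
    linear_combination h
  have key (u : QSpace q 2) : Deep ((q - q⁻¹)⁻¹ • (π.k i u - (π.k i).symm u)) := by
    have := (deep_e π h₁ h₂ (π.f i u)).sub (deep_f π h₃ h₄ (π.e i u))
    rwa [π.ef, if_pos rfl] at this
  have hα := hw.ne₁ i
  have hβ := hw.ne₂ i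
  constructor
  · have h := (key (P1 q)).2.1
    rw [hw.k_P1, hw.k_symm_P1, show P1 q = mono q (1, 0) by simp [mono], map_smul,
      map_sub, map_smul, map_smul, coef_mono, if_pos rfl, smul_eq_mul, smul_eq_mul, smul_eq_mul,
      mul_one, mul_one] at h
    have hsub := (mul_eq_zero.1 h).resolve_left hqq
    field_simp at hsub
    linear_combination hsub
  · have h := (key (P2 q)).2.2
    rw [hw.k_P2, hw.k_symm_P2, show P2 q = mono q (0, 1) by simp [mono], map_smul,
      map_sub, map_smul, map_smul, coef_mono, if_pos rfl, smul_eq_mul, smul_eq_mul, smul_eq_mul,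
      mul_one, mul_one] at h
    have hsub := (mul_eq_zero.1 h).resolve_left hqq
    field_simp at hsub
    linear_combination hsub

/-- The possible weights of one `U_q(sl(2))`-triple, together with the constraint that they impose
on the other triple. -/
theorem HasWeights.cases (hq2 : q ^ 2 ≠ 1) (hq : q ≠ 0) (hw : HasWeights π α β)
    {i j : Fin 2} (hij : i ≠ j) :
    (α i ^ 2 = 1 ∧ β i ^ 2 = 1) ∨
    (α i = q ^ (-2 : ℤ) ∧ β i = q ^ (-1 : ℤ) ∧ α j = q) ∨
    (α i = q ^ (1 : ℤ) ∧ β i = q ^ (-2 : ℤ) ∧ β j = q) ∨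
    (α i = q ^ (2 : ℤ) ∧ β i = q ^ (-1 : ℤ) ∧ q * α j = 1) ∨
    (α i = q ^ (1 : ℤ) ∧ β i = q ^ (2 : ℤ) ∧ q * β j = 1) ∨
    (α i = q ^ (1 : ℤ) ∧ β i = q ^ (-1 : ℤ) ∧ α j = q⁻¹ * β j ∨
      α i = q ^ (1 : ℤ) ∧ β i = q ^ (-1 : ℤ) ∧ β j = q * α j) ∨
    (α i = q ^ (-3 : ℤ) ∧ β i = q ^ (-1 : ℤ) ∧ β j = q⁻¹ * α j) ∨
    (α i = q ^ (1 : ℤ) ∧ β i = q ^ (3 : ℤ) ∧ α j = q * β j) := by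
  have hα := hw.ne₁ i
  have hβ := hw.ne₂ i
  have inv_of {z : ℂ} (h : q * z = 1) : z = q ^ (-1 : ℤ) := by
    rw [zpow_neg_one]; exact eq_inv_of_mul_eq_one_right h
  by_cases h₁ : Deep (π.e i (P1 q))
  swap
  · rcases not_deep h₁ with h | h | h <;> have h' := hw.of_coef_e_P1 h <;>
      have hi := h' i <;> have hj := h' j <;>
      simp only [cartan_self, cartan_of_ne hij.symm, pow_zero, pow_one, one_mul, mul_one,
        zpow_neg_one] at hi hj
    · refine .inr (.inl ⟨?_, inv_of (hw.of_coef_axis_e_P1 h), ?_⟩)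
      · rw [zpow_neg]; exact eq_inv_of_mul_eq_one_right hi.symm
      · field_simp at hj; exact hj.symm
    · exact absurd (mul_right_cancel₀ hα (by rw [one_mul]; exact_mod_cast hi.symm)) hq2
    · have hb := inv_of (hw.of_coef_axis_e_P1 h)
      refine .inr (.inr (.inr (.inr (.inr (.inr (.inl ⟨?_, hb, hj⟩))))))
      rw [hb] at hi
      rw [show (-3 : ℤ) = -2 + -1 by norm_num, zpow_add₀ hq, hi, ← mul_assoc, ← zpow_add₀ hq]
      simp
  by_cases h₂ : Deep (π.e i (P2 q))
  swap
  · rcases not_deep h₂ with h | h | h <;> have h' := hw.of_coef_e_P2 h <;>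
      have hi := h' i <;> have hj := h' j <;>
      simp only [cartan_self, cartan_of_ne hij.symm, pow_zero, pow_one, one_mul, mul_one,
        zpow_neg_one] at hi hj
    · refine .inr (.inr (.inl ⟨by rw [hw.of_coef_axis_e_P2 h, zpow_one], ?_, ?_⟩))
      · rw [zpow_neg]; exact eq_inv_of_mul_eq_one_right hi.symm
      · field_simp at hj; exact hj.symm
    · have ha := hw.of_coef_axis_e_P2 h
      refine .inr (.inr (.inr (.inr (.inr (.inl (.inl ⟨by rw [ha, zpow_one], ?_, hj⟩))))))
      apply inv_of
      rw [ha] at hi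
      refine mul_left_cancel₀ hq ?_
      rw [← mul_assoc, mul_one, ← sq]; exact_mod_cast hi.symm
    · exact absurd (mul_right_cancel₀ hβ (by rw [one_mul]; exact_mod_cast hi.symm)) hq2
  by_cases h₃ : Deep (π.f i (P1 q))
  swap
  · rcases not_deep h₃ with h | h | h <;> have h' := hw.of_coef_f_P1 h <;>
      have hi := h' i <;> have hj := h' j <;>
      simp only [cartan_self, cartan_of_ne hij.symm, pow_zero, pow_one, one_mul, mul_one,
        zpow_one, neg_neg, zpow_neg] at hi hj
    · refine .inr (.inr (.inr (.inl ⟨?_, inv_of (hw.of_coef_axis_f_P1 h), hj.symm⟩)))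
      rw [eq_inv_mul_iff_mul_eq₀ (zpow_ne_zero _ hq), mul_one] at hi
      exact hi.symm
    · rw [eq_inv_mul_iff_mul_eq₀ (zpow_ne_zero _ hq)] at hi
      exact absurd (mul_right_cancel₀ hα (by rw [one_mul]; exact_mod_cast hi)) hq2
    · have hb := inv_of (hw.of_coef_axis_f_P1 h)
      refine .inr (.inr (.inr (.inr (.inr (.inl (.inr ⟨?_, hb, hj⟩))))))
      rw [eq_inv_mul_iff_mul_eq₀ (zpow_ne_zero _ hq), hb, ← zpow_add₀ hq] at hi
      exact hi.symm
  by_cases h₄ : Deep (π.f i (P2 q))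
  swap
  · rcases not_deep h₄ with h | h | h <;> have h' := hw.of_coef_f_P2 h <;>
      have hi := h' i <;> have hj := h' j <;>
      simp only [cartan_self, cartan_of_ne hij.symm, pow_zero, pow_one, one_mul, mul_one,
        zpow_one, neg_neg, zpow_neg] at hi hj <;>
      rw [eq_inv_mul_iff_mul_eq₀ (zpow_ne_zero _ hq)] at hi
    · refine .inr (.inr (.inr (.inr (.inl ⟨?_, ?_, hj.symm⟩))))
      · rw [hw.of_coef_axis_f_P2 h, zpow_one]
      · rw [← hi, mul_one]
    · have ha := hw.of_coef_axis_f_P2 h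
      refine .inr (.inr (.inr (.inr (.inr (.inr (.inr ⟨by rw [ha, zpow_one], ?_, hj⟩))))))
      rw [← hi, ha, show (3 : ℤ) = 2 + 1 by norm_num, zpow_add₀ hq, zpow_one]
    · exact absurd (mul_right_cancel₀ hβ (by rw [one_mul]; exact_mod_cast hi)) hq2
  exact .inl (hw.sq_eq_one_of_deep hq2 hq h₁ h₂ h₃ h₄)

/-- Integral logarithms of the weights, up to signs. -/
structure HasExponents (q : ℂ) (α β : Fin 2 → ℂ) (n m : Fin 2 → ℤ) : Prop where
  sq₁ : ∀ l, α l ^ 2 = q ^ (2 * n l)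
  sq₂ : ∀ l, β l ^ 2 = q ^ (2 * m l)
  exact : ∀ l, (n l = 0 ∧ m l = 0) ∨ (α l = q ^ n l ∧ β l = q ^ m l)

theorem HasWeights.exists_hasExponents (hq2 : q ^ 2 ≠ 1) (hq : q ≠ 0) (hw : HasWeights π α β) :
    ∃ n m, HasExponents q α β n m := by
  have key (l : Fin 2) : ∃ n m : ℤ, α l ^ 2 = q ^ (2 * n) ∧ β l ^ 2 = q ^ (2 * m) ∧
      ((n = 0 ∧ m = 0) ∨ (α l = q ^ n ∧ β l = q ^ m)) := by
    have aux {a b : ℤ} (ha : α l = q ^ a) (hb : β l = q ^ b) :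
        ∃ n m : ℤ, α l ^ 2 = q ^ (2 * n) ∧ β l ^ 2 = q ^ (2 * m) ∧
          ((n = 0 ∧ m = 0) ∨ (α l = q ^ n ∧ β l = q ^ m)) :=
      ⟨a, b, by rw [ha, ← zpow_natCast, ← zpow_mul, mul_comm]; rfl,
        by rw [hb, ← zpow_natCast, ← zpow_mul, mul_comm]; rfl, .inr ⟨ha, hb⟩⟩
    have hl : l ≠ l + 1 := by fin_cases l <;> decide
    rcases hw.cases hq2 hq hl with h | h | h | h | h | (h | h) | h | h
    · exact ⟨0, 0, by simpa using h.1, by simpa using h.2, .inl ⟨rfl, rfl⟩⟩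
    all_goals exact aux h.1 h.2.1
  choose n m h₁ h₂ h₃ using key
  exact ⟨n, m, h₁, h₂, h₃⟩

variable {n m : Fin 2 → ℤ}

theorem HasExponents.eq₁ (hq : q ≠ 0) (hq' : ∀ N : ℕ, 0 < N → q ^ N ≠ 1)
    (h : HasExponents q α β n m) {l : Fin 2} {a : ℤ} (ha : α l ^ 2 = q ^ (2 * a)) : n l = a := by
  have := zpow_inj hq hq' ((h.sq₁ l).symm.trans ha)
  omega

theorem HasExponents.eq₂ (hq : q ≠ 0) (hq' : ∀ N : ℕ, 0 < N → q ^ N ≠ 1)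
    (h : HasExponents q α β n m) {l : Fin 2} {a : ℤ} (ha : β l ^ 2 = q ^ (2 * a)) : m l = a := by
  have := zpow_inj hq hq' ((h.sq₂ l).symm.trans ha)
  omega

theorem HasExponents.cases (hq : q ≠ 0) (hq' : ∀ N : ℕ, 0 < N → q ^ N ≠ 1)
    (h : HasExponents q α β n m) (hw : HasWeights π α β) {i j : Fin 2} (hij : i ≠ j) :
    (n i = 0 ∧ m i = 0) ∨ (n i = -2 ∧ m i = -1 ∧ n j = 1) ∨ (n i = 1 ∧ m i = -2 ∧ m j = 1) ∨
    (n i = 2 ∧ m i = -1 ∧ n j = -1) ∨ (n i = 1 ∧ m i = 2 ∧ m j = -1) ∨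
    (n i = 1 ∧ m i = -1 ∧ m j = n j + 1) ∨ (n i = -3 ∧ m i = -1 ∧ m j = n j - 1) ∨
    (n i = 1 ∧ m i = 3 ∧ n j = m j + 1) := by
  have sq_zpow (a : ℤ) : (q ^ a) ^ 2 = q ^ (2 * a) := by
    rw [← zpow_natCast, ← zpow_mul, mul_comm]; rfl
  have e₁ {l : Fin 2} {a : ℤ} (ha : α l = q ^ a) : n l = a :=
    h.eq₁ hq hq' (by rw [ha, sq_zpow])
  have e₂ {l : Fin 2} {a : ℤ} (ha : β l = q ^ a) : m l = a :=
    h.eq₂ hq hq' (by rw [ha, sq_zpow])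
  have inv_of {z : ℂ} (h : q * z = 1) : z = q ^ (-1 : ℤ) := by
    rw [zpow_neg_one]; exact eq_inv_of_mul_eq_one_right h
  have e₃ {l : Fin 2} {a : ℤ} (ha : β l = q ^ a * α l) : m l = n l + a :=
    h.eq₂ hq hq' (by rw [ha, mul_pow, sq_zpow, h.sq₁, ← zpow_add₀ hq]; ring_nf)
  have e₄ {l : Fin 2} {a : ℤ} (ha : α l = q ^ a * β l) : n l = m l + a :=
    h.eq₁ hq hq' (by rw [ha, mul_pow, sq_zpow, h.sq₂, ← zpow_add₀ hq]; ring_nf)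
  rcases hw.cases (hq' 2 two_pos) hq hij with c | c | c | c | c | (c | c) | c | c
  · exact .inl ⟨h.eq₁ hq hq' (by simpa using c.1), h.eq₂ hq hq' (by simpa using c.2)⟩
  all_goals have h₁ := e₁ c.1
  all_goals have h₂ := e₂ c.2.1
  · have := e₁ (a := 1) (by simpa using c.2.2); omega
  · have := e₂ (a := 1) (by simpa using c.2.2); omega
  · have := e₁ (inv_of c.2.2); omega
  · have := e₂ (inv_of c.2.2); omega
  · have := e₄ (a := -1) (by simpa using c.2.2); omega
  · have := e₃ (a := 1) (by simpa using c.2.2); omega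
  · have := e₃ (a := -1) (by simpa using c.2.2); omega
  · have := e₄ (a := 1) (by simpa using c.2.2); omega

theorem HasExponents.classification (hq : q ≠ 0) (hq' : ∀ N : ℕ, 0 < N → q ^ N ≠ 1)
    (h : HasExponents q α β n m) (hw : HasWeights π α β) :
    (∀ l, n l = 0 ∧ m l = 0) ∨ ∃ i j, i ≠ j ∧
      (((n i = -2 ∧ m i = -1) ∧ n j = 1 ∧ m j = -1) ∨
        ((n i = 1 ∧ m i = 2) ∧ n j = 1 ∧ m j = -1) ∨
        ((n i = -2 ∧ m i = -1) ∧ n j = 1 ∧ m j = 2)) := by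
  have h₀ := h.cases hq hq' hw (i := 0) (j := 1) (by decide)
  have h₁ := h.cases hq hq' hw (i := 1) (j := 0) (by decide)
  rcases h₀ with h₀ | h₀ | h₀ | h₀ | h₀ | h₀ | h₀ | h₀ <;>
    rcases h₁ with h₁ | h₁ | h₁ | h₁ | h₁ | h₁ | h₁ | h₁ <;>
    first
      | exfalso; omega
      | skip
  · exact .inl (Fin.forall_fin_two.2 ⟨h₀, h₁⟩)
  · exact .inr ⟨0, 1, by decide, by omega⟩
  · exact .inr ⟨0, 1, by decide, by omega⟩
  · exact .inr ⟨1, 0, by decide, by omega⟩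
  · exact .inr ⟨0, 1, by decide, by omega⟩
  · exact .inr ⟨1, 0, by decide, by omega⟩
  · exact .inr ⟨1, 0, by decide, by omega⟩

theorem HasExponents.of_coef (hq : q ≠ 0) (hq' : ∀ N : ℕ, 0 < N → q ^ N ≠ 1)
    (h : HasExponents q α β n m) {l : Fin 2} {a b : ℕ} {c d : ℤ} {z : ℂ}
    (hz : z ^ 2 = q ^ (2 * d)) (hab : α l ^ a * β l ^ b = q ^ c * z) :
    n l * a + m l * b = c + d := by
  have := congrArg (· ^ 2) hab
  simp only [mul_pow, ← pow_mul, mul_comm _ 2] at this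
  rw [pow_mul, pow_mul, h.sq₁, h.sq₂, hz, ← zpow_natCast, ← zpow_natCast, ← zpow_natCast,
    ← zpow_mul, ← zpow_mul, ← zpow_mul, ← zpow_add₀ hq, ← zpow_add₀ hq] at this
  have := zpow_inj hq hq' this
  push_cast at this
  linarith

end Weights

@[simp] theorem coef_P1 (q : ℂ) : coef q (1, 0) (P1 q) = 1 := by
  simpa [mono] using coef_mono q (1, 0) (1, 0)

@[simp] theorem coef_P2 (q : ℂ) : coef q (0, 1) (P2 q) = 1 := by
  simpa [mono] using coef_mono q (0, 1) (0, 1)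

theorem eq_zero_of_coef {q : ℂ} {u : QSpace q 2} (h : ∀ a b, ¬ coef q (a, b) u ≠ 0) : u = 0 :=
  ext_coef fun ⟨a, b⟩ => by simpa using h a b

theorem exists_eq_smul_mono {q : ℂ} {u : QSpace q 2} (a b : ℕ)
    (h : ∀ c d, coef q (c, d) u ≠ 0 → c = a ∧ d = b) :
    ∃ s : ℂ, u = s • (P1 q ^ a * P2 q ^ b) :=
  ⟨_, eq_smul_mono (a, b) fun ⟨c, d⟩ hr => Prod.ext_iff.2 (h c d hr)⟩

theorem mul_eq_neg_of_quadratic {q s c : ℂ} (hq : q ≠ 0) (hq4 : q ^ 4 ≠ 1)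
    (h : s * (c + c * (q ^ 2)⁻¹) = (q - q⁻¹)⁻¹ * ((q ^ 2)⁻¹ - q ^ 2)) : s * c = -q := by
  have h4 : q ^ 4 - 1 ≠ 0 := sub_ne_zero.2 hq4
  have h2 : q ^ 2 - 1 ≠ 0 := fun h => h4 (by linear_combination (q ^ 2 + 1) * h)
  have h1 : (q - q⁻¹)⁻¹ = q / (q ^ 2 - 1) := by field_simp
  rw [h1] at h
  field_simp at h
  refine mul_left_cancel₀ h4 ?_
  linear_combination h

theorem mul_eq_neg_of_linear {q t c : ℂ} (hq : q ≠ 0) (hq2 : q ^ 2 ≠ 1)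
    (h : t * (c * q⁻¹) = (q - q⁻¹)⁻¹ * (q⁻¹ - q)) : t * c = -q := by
  have h2 : q ^ 2 - 1 ≠ 0 := sub_ne_zero.2 hq2
  have h1 : (q - q⁻¹)⁻¹ = q / (q ^ 2 - 1) := by field_simp
  rw [h1] at h
  field_simp at h
  refine mul_left_cancel₀ h2 ?_
  linear_combination h

theorem ne_zero_and_eq {q s c : ℂ} (hq : q ≠ 0) (h : s * c = -q) : c ≠ 0 ∧ s = -q * c⁻¹ := by
  have hc : c ≠ 0 := by
    rintro rfl
    exact hq (by linear_combination h)
  exact ⟨hc, by rw [← h, mul_assoc, mul_inv_cancel₀ hc, mul_one]⟩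

section Shapes

variable {q : ℂ} {π : UqslMA q 2 (QSpace q 2)} {α β : Fin 2 → ℂ} {n m : Fin 2 → ℤ}
  (hq : q ≠ 0) (hq' : ∀ N : ℕ, 0 < N → q ^ N ≠ 1)
  (h : HasExponents q α β n m) (hw : HasWeights π α β)
include hq hq' h hw

theorem exponents_e_P1 {i : Fin 2} {a b : ℕ} (hab : coef q (a, b) (π.e i (P1 q)) ≠ 0)
    (l : Fin 2) : n l * a + m l * b = cartan 2 l i + n l :=
  h.of_coef hq hq' (h.sq₁ l) (hw.of_coef_e_P1 hab l)

theorem exponents_e_P2 {i : Fin 2} {a b : ℕ} (hab : coef q (a, b) (π.e i (P2 q)) ≠ 0)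
    (l : Fin 2) : n l * a + m l * b = cartan 2 l i + m l :=
  h.of_coef hq hq' (h.sq₂ l) (hw.of_coef_e_P2 hab l)

theorem exponents_f_P1 {i : Fin 2} {a b : ℕ} (hab : coef q (a, b) (π.f i (P1 q)) ≠ 0)
    (l : Fin 2) : n l * a + m l * b = -cartan 2 l i + n l :=
  h.of_coef hq hq' (h.sq₁ l) (hw.of_coef_f_P1 hab l)

theorem exponents_f_P2 {i : Fin 2} {a b : ℕ} (hab : coef q (a, b) (π.f i (P2 q)) ≠ 0)
    (l : Fin 2) : n l * a + m l * b = -cartan 2 l i + m l :=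
  h.of_coef hq hq' (h.sq₂ l) (hw.of_coef_f_P2 hab l)

theorem trivial_shape {i : Fin 2} (hn : n i = 0) (hm : m i = 0) :
    π.e i (P1 q) = 0 ∧ π.e i (P2 q) = 0 ∧ π.f i (P1 q) = 0 ∧ π.f i (P2 q) = 0 := by
  refine ⟨eq_zero_of_coef fun a b hab => ?_, eq_zero_of_coef fun a b hab => ?_,
    eq_zero_of_coef fun a b hab => ?_, eq_zero_of_coef fun a b hab => ?_⟩
  · simpa [hn, hm, cartan_self] using exponents_e_P1 hq hq' h hw hab i
  · simpa [hn, hm, cartan_self] using exponents_e_P2 hq hq' h hw hab i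
  · simpa [hn, hm, cartan_self] using exponents_f_P1 hq hq' h hw hab i
  · simpa [hn, hm, cartan_self] using exponents_f_P2 hq hq' h hw hab i

/-- The shape of a triple for which `e` lowers `x₁` to a constant. -/
theorem lowering_shape {i j : Fin 2} (hij : i ≠ j) (hn : n i = -2) (hm : m i = -1)
    (hn' : n j = 1) (hm' : m j = -1 ∨ m j = 2) :
    ∃ c : ℂ, c ≠ 0 ∧ π.e i (P1 q) = c • 1 ∧ π.e i (P2 q) = 0 ∧
      π.f i (P1 q) = (-q * c⁻¹) • (P1 q * P1 q) ∧ π.f i (P2 q) = (-q * c⁻¹) • (P1 q * P2 q) := by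
  have hα : α i = (q ^ 2)⁻¹ := by
    rcases h.exact i with h' | h'
    · omega
    · rw [h'.1, hn, zpow_neg]; rfl
  have hβ : β i = q⁻¹ := by
    rcases h.exact i with h' | h'
    · omega
    · rw [h'.2, hm, zpow_neg_one]
  obtain ⟨c, hc⟩ := exists_eq_smul_mono (u := π.e i (P1 q)) 0 0 fun a b hab => by
    have hi := exponents_e_P1 hq hq' h hw hab i
    rw [hn, hm, cartan_self] at hi
    omega
  have h₂ : π.e i (P2 q) = 0 := eq_zero_of_coef fun a b hab => by
    have hi := exponents_e_P2 hq hq' h hw hab i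
    rw [hn, hm, cartan_self] at hi
    omega
  obtain ⟨s, hs⟩ := exists_eq_smul_mono (u := π.f i (P1 q)) 2 0 fun a b hab => by
    have hi := exponents_f_P1 hq hq' h hw hab i
    have hj := exponents_f_P1 hq hq' h hw hab j
    rw [hn, hm, cartan_self] at hi
    rw [hn', cartan_of_ne hij.symm] at hj
    rcases hm' with hm' | hm' <;> rw [hm'] at hj <;> omega
  obtain ⟨t, ht⟩ := exists_eq_smul_mono (u := π.f i (P2 q)) 1 1 fun a b hab => by
    have hi := exponents_f_P2 hq hq' h hw hab i
    have hj := exponents_f_P2 hq hq' h hw hab j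
    rw [hn, hm, cartan_self] at hi
    rw [hn', cartan_of_ne hij.symm] at hj
    rcases hm' with hm' | hm' <;> rw [hm'] at hj <;> omega
  simp only [pow_zero, mul_one, pow_one, sq] at hc hs ht
  have hsc : s * c = -q := by
    refine mul_eq_neg_of_quadratic hq (hq' 4 (by norm_num)) ?_
    have := congrArg (coef q (1, 0)) (π.ef i i (P1 q))
    simp [hc, hs, π.e_mul, π.f_one, hw.k_P1, hw.k_symm_P1, hα] at this
    linear_combination this
  have htc : t * c = -q := by
    refine mul_eq_neg_of_linear hq (hq' 2 two_pos) ?_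
    have := congrArg (coef q (0, 1)) (π.ef i i (P2 q))
    simp [hc, h₂, ht, π.e_mul, hw.k_P2, hw.k_symm_P2, hβ] at this
    linear_combination this
  obtain ⟨hc0, rfl⟩ := ne_zero_and_eq hq hsc
  obtain ⟨-, rfl⟩ := ne_zero_and_eq hq htc
  exact ⟨c, hc0, hc, h₂, hs, ht⟩

/-- The shape of a triple for which `f` lowers `x₂` to a constant. -/
theorem raising_shape {i j : Fin 2} (hij : i ≠ j) (hn : n i = 1) (hm : m i = 2)
    (hn' : n j = 1 ∨ n j = -2) (hm' : m j = -1) :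
    ∃ c : ℂ, c ≠ 0 ∧ π.f i (P2 q) = c • 1 ∧ π.f i (P1 q) = 0 ∧
      π.e i (P1 q) = (-q * c⁻¹) • (P1 q * P2 q) ∧ π.e i (P2 q) = (-q * c⁻¹) • (P2 q * P2 q) := by
  have hα : α i = q := by
    rcases h.exact i with h' | h'
    · omega
    · rw [h'.1, hn, zpow_one]
  have hβ : β i = q ^ 2 := by
    rcases h.exact i with h' | h'
    · omega
    · rw [h'.2, hm]; rfl
  obtain ⟨c, hc⟩ := exists_eq_smul_mono (u := π.f i (P2 q)) 0 0 fun a b hab => by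
    have hi := exponents_f_P2 hq hq' h hw hab i
    rw [hn, hm, cartan_self] at hi
    omega
  have h₂ : π.f i (P1 q) = 0 := eq_zero_of_coef fun a b hab => by
    have hi := exponents_f_P1 hq hq' h hw hab i
    rw [hn, hm, cartan_self] at hi
    omega
  obtain ⟨s, hs⟩ := exists_eq_smul_mono (u := π.e i (P1 q)) 1 1 fun a b hab => by
    have hi := exponents_e_P1 hq hq' h hw hab i
    have hj := exponents_e_P1 hq hq' h hw hab j
    rw [hn, hm, cartan_self] at hi
    rw [hm', cartan_of_ne hij.symm] at hj
    rcases hn' with hn' | hn' <;> rw [hn'] at hj <;> omega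
  obtain ⟨t, ht⟩ := exists_eq_smul_mono (u := π.e i (P2 q)) 0 2 fun a b hab => by
    have hi := exponents_e_P2 hq hq' h hw hab i
    have hj := exponents_e_P2 hq hq' h hw hab j
    rw [hn, hm, cartan_self] at hi
    rw [hm', cartan_of_ne hij.symm] at hj
    rcases hn' with hn' | hn' <;> rw [hn'] at hj <;> omega
  simp only [pow_zero, mul_one, one_mul, pow_one, sq] at hc hs ht
  have hsc : s * c = -q := by
    refine mul_eq_neg_of_linear hq (hq' 2 two_pos) ?_
    have := congrArg (coef q (1, 0)) (π.ef i i (P1 q))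
    simp [hc, hs, h₂, π.f_mul, hw.k_P1, hw.k_symm_P1, hα] at this
    linear_combination -this
  have htc : t * c = -q := by
    refine mul_eq_neg_of_quadratic hq (hq' 4 (by norm_num)) ?_
    have := congrArg (coef q (0, 1)) (π.ef i i (P2 q))
    simp [hc, ht, π.f_mul, π.e_one, hw.k_P2, hw.k_symm_P2, hβ] at this
    linear_combination -this
  obtain ⟨hc0, rfl⟩ := ne_zero_and_eq hq hsc
  obtain ⟨-, rfl⟩ := ne_zero_and_eq hq htc
  exact ⟨c, hc0, hc, h₂, hs, ht⟩

/-- The shape of a triple which acts through the vector representation. -/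
theorem standard_shape {i j : Fin 2} (hij : i ≠ j) (hn : n i = 1) (hm : m i = -1)
    (hj' : (n j = -2 ∧ m j = -1) ∨ (n j = 1 ∧ m j = 2)) :
    ∃ c : ℂ, c ≠ 0 ∧ π.e i (P1 q) = 0 ∧ π.e i (P2 q) = c • P1 q ∧
      π.f i (P1 q) = c⁻¹ • P2 q ∧ π.f i (P2 q) = 0 := by
  have hα : α i = q := by
    rcases h.exact i with h' | h'
    · omega
    · rw [h'.1, hn, zpow_one]
  have h₁ : π.e i (P1 q) = 0 := eq_zero_of_coef fun a b hab => by
    have hi := exponents_e_P1 hq hq' h hw hab i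
    have hj := exponents_e_P1 hq hq' h hw hab j
    rw [hn, hm, cartan_self] at hi
    rw [cartan_of_ne hij.symm] at hj
    rcases hj' with ⟨hn', hm'⟩ | ⟨hn', hm'⟩ <;> rw [hn', hm'] at hj <;> omega
  have h₂ : π.f i (P2 q) = 0 := eq_zero_of_coef fun a b hab => by
    have hi := exponents_f_P2 hq hq' h hw hab i
    have hj := exponents_f_P2 hq hq' h hw hab j
    rw [hn, hm, cartan_self] at hi
    rw [cartan_of_ne hij.symm] at hj
    rcases hj' with ⟨hn', hm'⟩ | ⟨hn', hm'⟩ <;> rw [hn', hm'] at hj <;> omega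
  obtain ⟨c, hc⟩ := exists_eq_smul_mono (u := π.e i (P2 q)) 1 0 fun a b hab => by
    have hi := exponents_e_P2 hq hq' h hw hab i
    have hj := exponents_e_P2 hq hq' h hw hab j
    rw [hn, hm, cartan_self] at hi
    rw [cartan_of_ne hij.symm] at hj
    rcases hj' with ⟨hn', hm'⟩ | ⟨hn', hm'⟩ <;> rw [hn', hm'] at hj <;> omega
  obtain ⟨s, hs⟩ := exists_eq_smul_mono (u := π.f i (P1 q)) 0 1 fun a b hab => by
    have hi := exponents_f_P1 hq hq' h hw hab i
    have hj := exponents_f_P1 hq hq' h hw hab j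
    rw [hn, hm, cartan_self] at hi
    rw [cartan_of_ne hij.symm] at hj
    rcases hj' with ⟨hn', hm'⟩ | ⟨hn', hm'⟩ <;> rw [hn', hm'] at hj <;> omega
  simp only [pow_zero, mul_one, one_mul, pow_one] at hc hs
  have hqq : q - q⁻¹ ≠ 0 := fun h0 => hq' 2 two_pos <| by
    field_simp at h0
    linear_combination h0
  have hsc : s * c = 1 := by
    have := congrArg (coef q (1, 0)) (π.ef i i (P1 q))
    simpa [h₁, hs, hc, hw.k_P1, hw.k_symm_P1, hα, hqq] using this
  obtain rfl : s = c⁻¹ := eq_inv_of_mul_eq_one_left hsc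
  exact ⟨c, right_ne_zero_of_mul_eq_one hsc, h₁, hc, hs, h₂⟩

end Shapes

section Main

variable {q : ℂ}

theorem exists_iso_kind (hq : q ≠ 0) (hq' : ∀ N : ℕ, 0 < N → q ^ N ≠ 1)
    (π : UqslMA q 2 (QSpace q 2)) :
    ∃ π' : UqslMA q 2 (QSpace q 2), π.Iso π' ∧ ∃ a : Fin 4, KindOf q a π' := by
  obtain ⟨α, β, hw⟩ := exists_hasWeights hq (hq' 2 two_pos) π
  obtain ⟨n, m, h⟩ := hw.exists_hasExponents (hq' 2 two_pos) hq
  have weights {l : Fin 2} (hl : n l ≠ 0) : α l = q ^ n l ∧ β l = q ^ m l :=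
    (h.exact l).resolve_left fun h0 => hl h0.1
  obtain h0 | ⟨i, j, hij, ⟨⟨hni, hmi⟩, hnj, hmj⟩ | ⟨⟨hni, hmi⟩, hnj, hmj⟩ |
    ⟨⟨hni, hmi⟩, hnj, hmj⟩⟩ := h.classification hq hq' hw
  · refine ⟨π, ⟨AlgEquiv.refl, by simp, by simp, by simp, by simp⟩, 0, 0, 1, by decide,
      α 0, β 0, α 1, β 1, ?_⟩
    have sign₁ (l : Fin 2) : α l = 1 ∨ α l = -1 := by
      have := h.sq₁ l
      rw [(h0 l).1] at this
      simpa using this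
    have sign₂ (l : Fin 2) : β l = 1 ∨ β l = -1 := by
      have := h.sq₂ l
      rw [(h0 l).2] at this
      simpa using this
    obtain ⟨h₁, h₂, h₃, h₄⟩ := trivial_shape hq hq' h hw (h0 0).1 (h0 0).2
    obtain ⟨h₅, h₆, h₇, h₈⟩ := trivial_shape hq hq' h hw (h0 1).1 (h0 1).2
    exact ⟨sign₁ 0, sign₂ 0, sign₁ 1, sign₂ 1, hw.k_P1 0, hw.k_P2 0, hw.k_P1 1, hw.k_P2 1,
      h₁, h₂, h₅, h₆, h₃, h₄, h₇, h₈⟩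
  · obtain ⟨c, hc, e₁, e₂, f₁, f₂⟩ := lowering_shape hq hq' h hw hij hni hmi hnj (.inl hmj)
    obtain ⟨d, hd, e₃, e₄, f₃, f₄⟩ :=
      standard_shape hq hq' h hw hij.symm hnj hmj (.inl ⟨hni, hmi⟩)
    have wi := weights (l := i) (by omega)
    have wj := weights (l := j) (by omega)
    rw [hni, hmi] at wi
    rw [hnj, hmj] at wj
    refine ⟨transport π (scale q hc (mul_ne_zero hd hc)), iso_transport _ _, 1, i, j, hij, ?_⟩
    simp [transport, hw.k_P1, hw.k_P2, wi, wj, e₁, e₂, e₃, e₄, f₁, f₂, f₃, f₄, smul_smul, hc, hd]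
    field_simp
    simp
    exact ⟨(neg_smul _ _).symm, (neg_smul _ _).symm⟩
  · obtain ⟨c, hc, f₁, f₂, e₁, e₂⟩ := raising_shape hq hq' h hw hij hni hmi (.inl hnj) hmj
    obtain ⟨d, hd, e₃, e₄, f₃, f₄⟩ :=
      standard_shape hq hq' h hw hij.symm hnj hmj (.inr ⟨hni, hmi⟩)
    have wi := weights (l := i) (by omega)
    have wj := weights (l := j) (by omega)
    rw [hni, hmi] at wi
    rw [hnj, hmj] at wj
    refine ⟨transport π (scale q (mul_ne_zero (inv_ne_zero hd) hc) hc), iso_transport _ _, 2,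
      i, j, hij, ?_⟩
    simp [transport, hw.k_P1, hw.k_P2, wi, wj, e₁, e₂, e₃, e₄, f₁, f₂, f₃, f₄, smul_smul, hc, hd]
    field_simp
    simp
    exact ⟨(neg_smul _ _).symm, (neg_smul _ _).symm⟩
  · obtain ⟨c, hc, e₁, e₂, f₁, f₂⟩ := lowering_shape hq hq' h hw hij hni hmi hnj (.inr hmj)
    obtain ⟨d, hd, f₃, f₄, e₃, e₄⟩ := raising_shape hq hq' h hw hij.symm hnj hmj (.inr hni) hmi
    have wi := weights (l := i) (by omega)
    have wj := weights (l := j) (by omega)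
    rw [hni, hmi] at wi
    rw [hnj, hmj] at wj
    refine ⟨transport π (scale q hc hd), iso_transport _ _, 3, i, j, hij, ?_⟩
    simp [transport, hw.k_P1, hw.k_P2, wi, wj, e₁, e₂, e₃, e₄, f₁, f₂, f₃, f₄, smul_smul, hc, hd]
    field_simp
    simp
    exact ⟨(neg_smul _ _).symm, (neg_smul _ _).symm, (neg_smul _ _).symm, (neg_smul _ _).symm⟩

/-- The exponents of the weights of `k₁ k₂` on the two generators, for each kind. -/
def kindExponents : Fin 4 → ℤ × ℤ
  | 0 => (0, 0)
  | 1 => (-1, -2)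
  | 2 => (2, 1)
  | 3 => (-1, 1)

theorem kindExponents_injective : Function.Injective kindExponents := by decide

theorem KindOf.exists_weights (hq : q ≠ 0) {π : UqslMA q 2 (QSpace q 2)} {a : Fin 4}
    (h : KindOf q a π) : ∃ c d : ℂ, π.k 0 (π.k 1 (P1 q)) = c • P1 q ∧
      π.k 0 (π.k 1 (P2 q)) = d • P2 q ∧ c ^ 2 = q ^ (2 * (kindExponents a).1) ∧
      d ^ 2 = q ^ (2 * (kindExponents a).2) := by
  have key {i j : Fin 2} (hij : i ≠ j) {c₁ c₂ d₁ d₂ : ℂ} (h₁ : π.k i (P1 q) = c₁ • P1 q)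
      (h₂ : π.k i (P2 q) = d₁ • P2 q) (h₃ : π.k j (P1 q) = c₂ • P1 q)
      (h₄ : π.k j (P2 q) = d₂ • P2 q) : π.k 0 (π.k 1 (P1 q)) = (c₁ * c₂) • P1 q ∧
      π.k 0 (π.k 1 (P2 q)) = (d₁ * d₂) • P2 q := by
    have comm (u : QSpace q 2) : π.k 0 (π.k 1 u) = π.k i (π.k j u) := by
      fin_cases i <;> fin_cases j <;> first | exact absurd rfl hij | rfl | exact π.k_comm 0 1 u
    rw [comm, comm, h₃, h₄, map_smul, map_smul, h₁, h₂, smul_smul, smul_smul, mul_comm c₁,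
      mul_comm d₁]
    exact ⟨rfl, rfl⟩
  fin_cases a
  · obtain ⟨i, j, hij, ε₁, ε₂, δ₁, δ₂, s₁, s₂, s₃, s₄, h₁, h₂, h₃, h₄, -⟩ := h
    refine ⟨_, _, (key hij h₁ h₂ h₃ h₄).1, (key hij h₁ h₂ h₃ h₄).2, ?_, ?_⟩
    · rcases s₁ with rfl | rfl <;> rcases s₃ with rfl | rfl <;> simp [kindExponents]
    · rcases s₂ with rfl | rfl <;> rcases s₄ with rfl | rfl <;> simp [kindExponents]
  all_goals
    obtain ⟨i, j, hij, h₁, h₂, h₃, h₄, -⟩ := h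
    refine ⟨_, _, (key hij h₁ h₂ h₃ h₄).1, (key hij h₁ h₂ h₃ h₄).2, ?_, ?_⟩ <;>
      simp [kindExponents, zpow_neg] <;> field_simp

theorem kind_unique (hq : q ≠ 0) (hq' : ∀ N : ℕ, 0 < N → q ^ N ≠ 1)
    {π₁ π₂ : UqslMA q 2 (QSpace q 2)} {a b : Fin 4} (h₁ : KindOf q a π₁) (h₂ : KindOf q b π₂)
    (h : π₁.Iso π₂) : a = b := by
  obtain ⟨ψ, hk, -⟩ := h
  obtain ⟨c, d, hc0, hd0, hc, hd⟩ := automorphism_diagonal hq (hq' 2 two_pos) ψ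
  obtain ⟨r₁, s₁, hr₁, hs₁, er₁, es₁⟩ := KindOf.exists_weights hq h₁
  obtain ⟨r₂, s₂, hr₂, hs₂, er₂, es₂⟩ := KindOf.exists_weights hq h₂
  have comm (u : QSpace q 2) : ψ (π₁.k 0 (π₁.k 1 u)) = π₂.k 0 (π₂.k 1 (ψ u)) := by
    rw [← hk, ← hk]; simp
  have e₁ := congrArg (coef q (1, 0)) (comm (P1 q))
  have e₂ := congrArg (coef q (0, 1)) (comm (P2 q))
  rw [hr₁, hc] at e₁
  rw [hs₁, hd] at e₂
  simp [hr₂, hc] at e₁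
  simp [hs₂, hd] at e₂
  obtain rfl := mul_left_cancel₀ hc0 ((mul_comm c r₁).trans e₁)
  obtain rfl := mul_left_cancel₀ hd0 ((mul_comm d s₁).trans e₂)
  have er := zpow_inj hq hq' (er₁.symm.trans er₂)
  have es := zpow_inj hq hq' (es₁.symm.trans es₂)
  exact kindExponents_injective (Prod.ext (by omega) (by omega))

end Main

end QPlane

/-- Classification of `U_q(sl(3))`-module-algebra structures on the quantum plane `A_q(2)`:
every structure is isomorphic to one of the kinds (I)–(IV), and no two structures of
different kinds are isomorphic. -/
theorem classification_Uqsl3_on_Aq2 (q : ℂ) (hq : q ≠ 0)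
    (hq' : ∀ N : ℕ, 0 < N → q ^ N ≠ 1) :
    (∀ π : UqslMA q 2 (QSpace q 2), ∃ π' : UqslMA q 2 (QSpace q 2),
      π.Iso π' ∧ ∃ a : Fin 4, KindOf q a π') ∧
    (∀ (π₁ π₂ : UqslMA q 2 (QSpace q 2)) (a b : Fin 4),
      KindOf q a π₁ → KindOf q b π₂ → π₁.Iso π₂ → a = b) :=
  ⟨QPlane.exists_iso_kind hq hq', fun _ _ _ _ => QPlane.kind_unique hq hq'⟩
end
end

section
/- Let m ≥ 3. Every module-algebra structure of U_q(sl(m+1)) on the quantum plane A_q(2) satisfies: for every i ∈ {1, …, m} there exist ε_{i,1}, ε_{i,2} ∈ {1, −1} with k_i(x_1) = ε_{i,1}x_1, k_i(x_2) = ε_{i,2}x_2, and e_i(x_1) = e_i(x_2) = f_i(x_1) = f_i(x_2) = 0 (hence e_i = f_i = 0 on all of A_q(2)). -/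
noncomputable section

open scoped BigOperators

/-- The monomial `x_1 ^ a * x_2 ^ b` of the quantum plane. -/
def qmono (q : ℂ) (n : ℕ × ℕ) : QSpace q 2 := P1 q ^ n.1 * P2 q ^ n.2

lemma P2_mul_P1 (q : ℂ) : P2 q * P1 q = q • (P1 q * P2 q) := by
  have h := RingQuot.mkAlgHom_rel ℂ (QRel.rel (q := q) (n := 2) 1 0 (by decide))
  simpa [P1, P2, Xg] using h

lemma P2_mul_P1_pow (q : ℂ) (a : ℕ) : P2 q * P1 q ^ a = q ^ a • (P1 q ^ a * P2 q) := by
  induction a with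
  | zero => simp
  | succ a ih =>
    rw [pow_succ, ← mul_assoc, ih, smul_mul_assoc, mul_assoc, P2_mul_P1, mul_smul_comm, smul_smul,
      ← mul_assoc, ← pow_succ]

lemma P2_pow_mul_P1_pow (q : ℂ) (b a : ℕ) :
    P2 q ^ b * P1 q ^ a = q ^ (b * a) • (P1 q ^ a * P2 q ^ b) := by
  induction b with
  | zero => simp
  | succ b ih =>
    rw [pow_succ', mul_assoc, ih, mul_smul_comm, ← mul_assoc, P2_mul_P1_pow, smul_mul_assoc,
      smul_smul, mul_assoc, ← pow_add]
    congr 2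
    ring

lemma qmono_mul (q : ℂ) (a b : ℕ × ℕ) :
    qmono q a * qmono q b = q ^ (a.2 * b.1) • qmono q (a + b) := by
  simp only [qmono, Prod.fst_add, Prod.snd_add]
  rw [mul_assoc, ← mul_assoc (P2 q ^ a.2), P2_pow_mul_P1_pow, smul_mul_assoc, mul_smul_comm,
    pow_add, pow_add]
  simp only [mul_assoc]

/-- The representation of the quantum plane on finitely supported functions on `ℕ × ℕ` that
transports left multiplication along the monomial basis. -/
def planeRep (q : ℂ) : QSpace q 2 →ₐ[ℂ] Module.End ℂ ((ℕ × ℕ) →₀ ℂ) :=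
  RingQuot.liftAlgHom ℂ ⟨FreeAlgebra.lift ℂ
    ![Finsupp.linearCombination ℂ fun n : ℕ × ℕ => Finsupp.single (n + (1, 0)) (1 : ℂ),
      Finsupp.linearCombination ℂ fun n : ℕ × ℕ => Finsupp.single (n + (0, 1)) (q ^ n.1)], by
    rintro _ _ ⟨i, j, h⟩
    obtain ⟨rfl, rfl⟩ : i = 1 ∧ j = 0 := by omega
    ext n : 2
    simp [pow_succ, add_assoc, mul_comm]⟩

lemma planeRep_P1 (q : ℂ) (n : ℕ × ℕ) :
    planeRep q (P1 q) (Finsupp.single n 1) = Finsupp.single (n + (1, 0)) 1 := by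
  simp [planeRep, P1, Xg]

lemma planeRep_P2 (q : ℂ) (n : ℕ × ℕ) :
    planeRep q (P2 q) (Finsupp.single n 1) = Finsupp.single (n + (0, 1)) (q ^ n.1) := by
  simp [planeRep, P2, Xg]

lemma planeRep_qmono (q : ℂ) (n : ℕ × ℕ) :
    planeRep q (qmono q n) (Finsupp.single 0 1) = Finsupp.single n 1 := by
  have h2 (b : ℕ) : (planeRep q (P2 q) ^ b) (Finsupp.single 0 1) = Finsupp.single (0, b) 1 := by
    induction b with
    | zero => rfl
    | succ b ih => rw [pow_succ', Module.End.mul_apply, ih, planeRep_P2]; simp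
  have h1 (a b : ℕ) : (planeRep q (P1 q) ^ a) (Finsupp.single (0, b) 1) =
      Finsupp.single (a, b) 1 := by
    induction a with
    | zero => rfl
    | succ a ih => rw [pow_succ', Module.End.mul_apply, ih, planeRep_P1]; simp
  rw [qmono, map_mul, map_pow, map_pow, Module.End.mul_apply, h2, h1]

lemma qmono_linearIndependent (q : ℂ) : LinearIndependent ℂ (qmono q) := by
  refine LinearIndependent.of_comp
    ((LinearMap.applyₗ (Finsupp.single (0 : ℕ × ℕ) (1 : ℂ))).comp (planeRep q).toLinearMap) ?_
  have h : (((LinearMap.applyₗ (Finsupp.single (0 : ℕ × ℕ) (1 : ℂ))).comp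
      (planeRep q).toLinearMap) ∘ qmono q) = fun n => Finsupp.single n (1 : ℂ) := by
    funext n
    exact planeRep_qmono q n
  rw [h]
  exact Finsupp.linearIndependent_single_one ℂ (ℕ × ℕ)

lemma span_qmono (q : ℂ) : ⊤ ≤ Submodule.span ℂ (Set.range (qmono q)) := by
  set M := Submodule.span ℂ (Set.range (qmono q))
  have gen (n : ℕ × ℕ) (u : QSpace q 2) (hu : u ∈ M) : qmono q n * u ∈ M := by
    induction hu using Submodule.span_induction with
    | mem x hx =>
      obtain ⟨l, rfl⟩ := hx
      rw [qmono_mul]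
      exact M.smul_mem _ (Submodule.subset_span ⟨_, rfl⟩)
    | zero => simp
    | add x y _ _ hx hy => rw [mul_add]; exact M.add_mem hx hy
    | smul c x _ hx => rw [mul_smul_comm]; exact M.smul_mem _ hx
  have key (w : FreeAlgebra ℂ (Fin 2)) :
      ∀ u ∈ M, RingQuot.mkAlgHom ℂ (QRel q 2) w * u ∈ M := by
    induction w using FreeAlgebra.induction with
    | grade0 r =>
      intro u hu
      rw [AlgHom.commutes, ← Algebra.smul_def]
      exact M.smul_mem _ hu
    | grade1 i =>
      intro u hu
      fin_cases i
      · simpa [qmono, P1, Xg] using gen (1, 0) u hu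
      · simpa [qmono, P2, Xg] using gen (0, 1) u hu
    | mul a b ha hb =>
      intro u hu
      rw [map_mul, mul_assoc]
      exact ha _ (hb _ hu)
    | add a b ha hb =>
      intro u hu
      rw [map_add, add_mul]
      exact M.add_mem (ha _ hu) (hb _ hu)
  intro a _
  obtain ⟨w, rfl⟩ := RingQuot.mkAlgHom_surjective ℂ (QRel q 2) a
  have h1 : (1 : QSpace q 2) ∈ M := Submodule.subset_span ⟨0, by simp [qmono]⟩
  simpa using key w 1 h1

/-- The monomial basis of the quantum plane. -/
def qbasis (q : ℂ) : Module.Basis (ℕ × ℕ) ℂ (QSpace q 2) :=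
  Module.Basis.mk (qmono_linearIndependent q) (span_qmono q)

@[simp] lemma qbasis_apply (q : ℂ) (n : ℕ × ℕ) : qbasis q n = qmono q n :=
  Module.Basis.mk_apply _ _ _

@[simp] lemma qbasis_repr_qmono (q : ℂ) (n : ℕ × ℕ) :
    (qbasis q).repr (qmono q n) = Finsupp.single n 1 := by
  rw [← qbasis_apply, Module.Basis.repr_self]

lemma qbasis_repr_mul (q : ℂ) (u v : QSpace q 2) (n : ℕ × ℕ) :
    (qbasis q).repr (u * v) n =
      ∑ a ∈ ((qbasis q).repr u).support, ∑ b ∈ ((qbasis q).repr v).support,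
        if a + b = n then (qbasis q).repr u a * (qbasis q).repr v b * q ^ (a.2 * b.1) else 0 := by
  have hu := (qbasis q).linearCombination_repr u
  have hv := (qbasis q).linearCombination_repr v
  rw [Finsupp.linearCombination_apply, Finsupp.sum] at hu hv
  conv_lhs => rw [← hu, ← hv, Finset.sum_mul_sum]
  simp only [qbasis_apply, smul_mul_assoc, mul_smul_comm, qmono_mul, map_sum, map_smul,
    qbasis_repr_qmono, Finsupp.coe_finsetSum, Finset.sum_apply, Finsupp.smul_apply,
    Finsupp.single_apply, smul_eq_mul]
  refine Finset.sum_congr rfl fun a _ => Finset.sum_congr rfl fun b _ => ?_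
  split_ifs <;> ring

lemma eq_smul_qmono_of_card_support {q : ℂ} {u : QSpace q 2}
    (h : ((qbasis q).repr u).support.card = 1) : ∃ (c : ℂ) (a : ℕ × ℕ), c ≠ 0 ∧ u = c • qmono q a := by
  obtain ⟨a, ha, h⟩ := Finsupp.card_support_eq_one.1 h
  refine ⟨_, a, ha, (qbasis q).repr.injective ?_⟩
  rw [h]
  simp

/-- Factors of a nonzero multiple of a monomial are multiples of monomials. -/
lemma factors_of_mul_eq_smul_qmono {q : ℂ} (hq : q ≠ 0) {u v : QSpace q 2} {c : ℂ} {n : ℕ × ℕ}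
    (hc : c ≠ 0) (h : u * v = c • qmono q n) :
    ∃ (c₁ : ℂ) (a : ℕ × ℕ) (c₂ : ℂ) (b : ℕ × ℕ), c₁ ≠ 0 ∧ c₂ ≠ 0 ∧
      u = c₁ • qmono q a ∧ v = c₂ • qmono q b ∧ a + b = n := by
  have hn : qmono q n ≠ 0 := by
    rw [← qbasis_apply]
    exact (qbasis q).ne_zero n
  have h0 : u * v ≠ 0 := by
    rw [h]
    exact smul_ne_zero hc hn
  have hS : 0 < ((qbasis q).repr u).support.card := by
    rw [Finset.card_pos, Finsupp.support_nonempty_iff]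
    intro h1
    rw [(qbasis q).repr.map_eq_zero_iff] at h1
    simp [h1] at h0
  have hT : 0 < ((qbasis q).repr v).support.card := by
    rw [Finset.card_pos, Finsupp.support_nonempty_iff]
    intro h1
    rw [(qbasis q).repr.map_eq_zero_iff] at h1
    simp [h1] at h0
  have hST : ((qbasis q).repr u).support.card * ((qbasis q).repr v).support.card ≤ 1 := by
    by_contra! hlt
    obtain ⟨p₁, hp₁, p₂, hp₂, hne, hu₁, hu₂⟩ := TwoUniqueSums.uniqueAdd_of_one_lt_card hlt
    have key (p : (ℕ × ℕ) × (ℕ × ℕ))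
        (hp : p ∈ ((qbasis q).repr u).support ×ˢ ((qbasis q).repr v).support)
        (hu : UniqueAdd ((qbasis q).repr u).support ((qbasis q).repr v).support p.1 p.2) :
        p.1 + p.2 = n := by
      by_contra hpn
      rw [Finset.mem_product] at hp
      have h1 := qbasis_repr_mul q u v (p.1 + p.2)
      rw [Finset.sum_eq_single_of_mem p.1 hp.1, Finset.sum_eq_single_of_mem p.2 hp.2, h] at h1
      · simp [Ne.symm hpn, hq] at h1
        have := Finsupp.mem_support_iff.1 hp.1
        have := Finsupp.mem_support_iff.1 hp.2
        tauto
      · intro b hb hb'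
        exact if_neg fun hab => hb' (hu hp.1 hb hab).2
      · intro a ha ha'
        exact Finset.sum_eq_zero fun b hb => if_neg fun hab => ha' (hu ha hb hab).1
    rw [Finset.mem_product] at hp₁
    have h12 := hu₂ hp₁.1 hp₁.2 ((key p₁ (Finset.mem_product.2 hp₁) hu₁).trans
      (key p₂ hp₂ hu₂).symm)
    exact hne (Prod.ext h12.1 h12.2)
  obtain ⟨c₁, a, h₁, rfl⟩ := eq_smul_qmono_of_card_support (q := q) (u := u) (by nlinarith)
  obtain ⟨c₂, b, h₂, rfl⟩ := eq_smul_qmono_of_card_support (q := q) (u := v) (by nlinarith)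
  refine ⟨c₁, a, c₂, b, h₁, h₂, rfl, rfl, ?_⟩
  by_contra hab
  have h1 := congrArg (fun w => (qbasis q).repr w (a + b)) h
  simp [qmono_mul, Ne.symm hab, h₁, h₂, hq] at h1

/-- Modulo the ideal generated by `x_1 x_2` the quantum plane is commutative. -/
lemma qbasis_repr_mul_comm {q : ℂ} (u v : QSpace q 2) {n : ℕ × ℕ} (hn : n.1 = 0 ∨ n.2 = 0) :
    (qbasis q).repr (u * v) n = (qbasis q).repr (v * u) n := by
  rw [qbasis_repr_mul, qbasis_repr_mul, Finset.sum_comm]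
  refine Finset.sum_congr rfl fun a _ => Finset.sum_congr rfl fun b _ => ?_
  rw [add_comm b a]
  split_ifs with h
  · subst h
    simp only [Prod.fst_add, Prod.snd_add, Nat.add_eq_zero_iff] at hn
    obtain ⟨h1, h2⟩ | ⟨h1, h2⟩ := hn <;> simp [h1, h2, mul_comm]
  · rfl

lemma qbasis_repr_mul_eq_zero {q : ℂ} (hq1 : q ≠ 1) {u v : QSpace q 2}
    (h : v * u = q • (u * v)) {n : ℕ × ℕ} (hn : n.1 = 0 ∨ n.2 = 0) :
    (qbasis q).repr (u * v) n = 0 := by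
  have h1 := qbasis_repr_mul_comm u v hn
  rw [h, map_smul, Finsupp.smul_apply, smul_eq_mul] at h1
  have h2 : (q - 1) * (qbasis q).repr (u * v) n = 0 := by linear_combination -h1
  exact (mul_eq_zero.1 h2).resolve_left (sub_ne_zero.2 hq1)

/-- If `u`, `v` satisfy the relation of the quantum plane, then `x_1 x_2` divides `u * v`. -/
lemma exists_P1_mul_P2_mul_eq {q : ℂ} (hq : q ≠ 0) (hq1 : q ≠ 1) {u v : QSpace q 2}
    (h : v * u = q • (u * v)) : ∃ w, P1 q * P2 q * w = u * v := by
  suffices hs : u * v ∈ LinearMap.range (LinearMap.mulLeft ℂ (P1 q * P2 q)) by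
    exact hs
  rw [← (qbasis q).linearCombination_repr (u * v), Finsupp.linearCombination_apply, Finsupp.sum]
  refine Submodule.sum_mem _ fun n hn => Submodule.smul_mem _ _ ?_
  have hn' : ¬(n.1 = 0 ∨ n.2 = 0) := fun h0 =>
    Finsupp.mem_support_iff.1 hn (qbasis_repr_mul_eq_zero hq1 h h0)
  obtain ⟨a, b⟩ := n
  obtain ⟨a, rfl⟩ : ∃ a', a = 1 + a' := Nat.exists_eq_add_of_le (by omega)
  obtain ⟨b, rfl⟩ : ∃ b', b = 1 + b' := Nat.exists_eq_add_of_le (by omega)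
  refine ⟨(q ^ a)⁻¹ • qmono q (a, b), ?_⟩
  have h11 : P1 q * P2 q = qmono q (1, 1) := by simp [qmono]
  have hqa : q ^ a ≠ 0 := pow_ne_zero _ hq
  simp [h11, qmono_mul, smul_smul, hqa]

/-- Automorphisms of the quantum plane are diagonal. -/
lemma algEquiv_diagonal {q : ℂ} (hq : q ≠ 0) (hq' : ∀ N : ℕ, 0 < N → q ^ N ≠ 1)
    (φ : QSpace q 2 ≃ₐ[ℂ] QSpace q 2) :
    ∃ α β : ℂ, α ≠ 0 ∧ β ≠ 0 ∧ φ (P1 q) = α • P1 q ∧ φ (P2 q) = β • P2 q := by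
  have hq1 : q ≠ 1 := by simpa using hq' 1 one_pos
  have h11 : P1 q * P2 q = qmono q (1, 1) := by simp [qmono]
  have rel (ψ : QSpace q 2 ≃ₐ[ℂ] QSpace q 2) :
      ψ (P2 q) * ψ (P1 q) = q • (ψ (P1 q) * ψ (P2 q)) := by
    rw [← map_mul, P2_mul_P1, map_smul, map_mul]
  obtain ⟨z, hz⟩ := exists_P1_mul_P2_mul_eq hq hq1 (rel φ.symm)
  have hz' : (φ (P1 q) * φ (P2 q)) * φ z = (1 : ℂ) • qmono q (1, 1) := by
    rw [← map_mul, ← map_mul, hz, ← map_mul, AlgEquiv.apply_symm_apply, h11, one_smul]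
  obtain ⟨c, n, _, l, hc, _, hn, _, hnl⟩ := factors_of_mul_eq_smul_qmono hq one_ne_zero hz'
  have hn11 : n = (1, 1) := by
    have h0 : ¬(n.1 = 0 ∨ n.2 = 0) := by
      intro h0
      have := qbasis_repr_mul_eq_zero hq1 (rel φ) h0
      rw [hn] at this
      simp [hc] at this
    have e1 := congrArg Prod.fst hnl
    have e2 := congrArg Prod.snd hnl
    simp only [Prod.fst_add, Prod.snd_add] at e1 e2
    ext <;> simp <;> omega
  obtain ⟨α, a, β, b, hα, hβ, ha, hb, hab⟩ := factors_of_mul_eq_smul_qmono hq hc hn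
  have hrel := congrArg (fun w => (qbasis q).repr w (a + b)) (rel φ)
  simp only [ha, hb, smul_mul_assoc, mul_smul_comm, qmono_mul, map_smul, add_comm b a,
    qbasis_repr_qmono, Finsupp.smul_apply, Finsupp.single_eq_same, smul_eq_mul, mul_one] at hrel
  have hpow : q ^ (b.2 * a.1) = q ^ (1 + a.2 * b.1) := by
    refine mul_left_cancel₀ (mul_ne_zero hα hβ) ?_
    rw [pow_add, pow_one]
    linear_combination hrel
  rw [hn11] at hab
  obtain ⟨a1, a2⟩ := a
  obtain ⟨b1, b2⟩ := b
  simp only [Prod.mk_add_mk, Prod.mk.injEq] at hab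
  have hcases : (a1 = 0 ∧ b1 = 1 ∨ a1 = 1 ∧ b1 = 0) ∧ (a2 = 0 ∧ b2 = 1 ∨ a2 = 1 ∧ b2 = 0) := by
    omega
  have hq2 := hq' 2 two_pos
  obtain ⟨⟨rfl, rfl⟩ | ⟨rfl, rfl⟩, ⟨rfl, rfl⟩ | ⟨rfl, rfl⟩⟩ := hcases
  · exact absurd (by simpa using hpow.symm) hq1
  · exact absurd (by simpa using hpow.symm) hq2
  · exact ⟨α, β, hα, hβ, by simpa [qmono] using ha, by simpa [qmono] using hb⟩
  · exact absurd (by simpa using hpow.symm) hq1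

lemma repr_apply_of_diagonal {q α β : ℂ} {φ : QSpace q 2 ≃ₐ[ℂ] QSpace q 2}
    (h1 : φ (P1 q) = α • P1 q) (h2 : φ (P2 q) = β • P2 q) (a : QSpace q 2) (n : ℕ × ℕ) :
    (qbasis q).repr (φ a) n = α ^ n.1 * β ^ n.2 * (qbasis q).repr a n := by
  have hm (l : ℕ × ℕ) : φ (qmono q l) = (α ^ l.1 * β ^ l.2) • qmono q l := by
    simp [qmono, h1, h2, smul_pow, smul_smul, mul_comm]
  suffices hs : (Finsupp.lapply n ∘ₗ (qbasis q).repr.toLinearMap) ∘ₗ φ.toLinearMap =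
      (α ^ n.1 * β ^ n.2) • (Finsupp.lapply n ∘ₗ (qbasis q).repr.toLinearMap) from
    DFunLike.congr_fun hs a
  refine (qbasis q).ext fun l => ?_
  by_cases hl : l = n
  · subst hl
    simp [hm]
  · simp [hm, hl]

lemma exists_repr_ne_zero {q : ℂ} {g : QSpace q 2 →ₗ[ℂ] QSpace q 2} (hg : g ≠ 0) :
    ∃ n l, (qbasis q).repr (g (qmono q n)) l ≠ 0 := by
  by_contra! h
  refine hg ((qbasis q).ext fun n => (qbasis q).repr.injective ?_)
  ext l
  simpa using h n l

/-- The weight of a matrix coefficient of an operator that is an eigenvector for conjugation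
by a diagonal automorphism. -/
lemma weight_eq {q α β c : ℂ} {φ : QSpace q 2 ≃ₐ[ℂ] QSpace q 2}
    (h1 : φ (P1 q) = α • P1 q) (h2 : φ (P2 q) = β • P2 q) {g : QSpace q 2 →ₗ[ℂ] QSpace q 2}
    (hg : ∀ a, φ (g (φ.symm a)) = c • g a) {n l : ℕ × ℕ}
    (hnl : (qbasis q).repr (g (qmono q n)) l ≠ 0) :
    α ^ l.1 * β ^ l.2 = c * (α ^ n.1 * β ^ n.2) := by
  have hm : φ (qmono q n) = (α ^ n.1 * β ^ n.2) • qmono q n := by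
    simp [qmono, h1, h2, smul_pow, smul_smul, mul_comm]
  have h := hg (φ (qmono q n))
  rw [AlgEquiv.symm_apply_apply, hm, map_smul, smul_smul] at h
  have h' := congrArg (fun w => (qbasis q).repr w l) h
  simp only [repr_apply_of_diagonal h1 h2, map_smul, Finsupp.smul_apply, smul_eq_mul] at h'
  exact mul_right_cancel₀ hnl h'

lemma eq_zero_of_sign_weights {q α β c : ℂ} {φ : QSpace q 2 ≃ₐ[ℂ] QSpace q 2}
    (h1 : φ (P1 q) = α • P1 q) (h2 : φ (P2 q) = β • P2 q) {g : QSpace q 2 →ₗ[ℂ] QSpace q 2}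
    (hg : ∀ a, φ (g (φ.symm a)) = c • g a) (hα : α ^ 2 = 1) (hβ : β ^ 2 = 1) (hc : c ^ 2 ≠ 1) :
    g = 0 := by
  by_contra h0
  obtain ⟨n, l, hnl⟩ := exists_repr_ne_zero h0
  have h := congrArg (· ^ 2) (weight_eq h1 h2 hg hnl)
  have hs (n : ℕ × ℕ) : (α ^ n.1 * β ^ n.2) ^ 2 = 1 := by
    rw [mul_pow, ← pow_mul, ← pow_mul, mul_comm n.1, mul_comm n.2, pow_mul, pow_mul, hα, hβ]
    simp
  simp only [mul_pow c, hs, mul_one] at h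
  exact hc h.symm

lemma eq_zero_of_zpow_eq_one {q : ℂ} (hq' : ∀ N : ℕ, 0 < N → q ^ N ≠ 1) {z : ℤ}
    (h : q ^ z = 1) : z = 0 := by
  by_contra hz
  refine hq' z.natAbs (Int.natAbs_pos.2 hz) ?_
  obtain h' | h' := Int.natAbs_eq z
  · rwa [h', zpow_natCast] at h
  · rwa [h', zpow_neg, zpow_natCast, inv_eq_one] at h

/-- Three elements of `ℤ²` cannot have the Cartan matrix of type `A₃` as their matrix of
weights. -/
lemma not_cartan_weights {q : ℂ} (hq : q ≠ 0) (hq' : ∀ N : ℕ, 0 < N → q ^ N ≠ 1)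
    (α β : Fin 3 → ℂ) (hα : ∀ i, α i ≠ 0) (hβ : ∀ i, β i ≠ 0) (r s : Fin 3 → ℤ)
    (h : ∀ i j, α i ^ r j * β i ^ s j = q ^ cartan 3 i j) : False := by
  have key (c : Fin 3 → ℤ) (hr : c 0 * r 0 + c 1 * r 1 + c 2 * r 2 = 0)
      (hs : c 0 * s 0 + c 1 * s 1 + c 2 * s 2 = 0) : c 0 = 0 ∧ c 1 = 0 ∧ c 2 = 0 := by
    have hi (i : Fin 3) :
        cartan 3 i 0 * c 0 + cartan 3 i 1 * c 1 + cartan 3 i 2 * c 2 = 0 := by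
      apply eq_zero_of_zpow_eq_one hq'
      rw [zpow_add₀ hq, zpow_add₀ hq, zpow_mul, zpow_mul, zpow_mul, ← h, ← h, ← h]
      calc _ = α i ^ (c 0 * r 0 + c 1 * r 1 + c 2 * r 2) *
            β i ^ (c 0 * s 0 + c 1 * s 1 + c 2 * s 2) := by
            simp only [zpow_add₀ (hα i), zpow_add₀ (hβ i), mul_zpow, ← zpow_mul, mul_comm (c _)]
            ring
        _ = 1 := by simp [hr, hs]
    have h0 := hi 0
    have h1 := hi 1
    have h2 := hi 2
    simp [cartan] at h0 h1 h2
    omega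
  obtain ⟨-, -, h01⟩ := key ![r 1 * s 2 - r 2 * s 1, r 2 * s 0 - r 0 * s 2, r 0 * s 1 - r 1 * s 0]
    (by simp; ring) (by simp; ring)
  simp only [Matrix.cons_val] at h01
  obtain ⟨hr1, hr0, -⟩ := key ![r 1, -r 0, 0] (by simp; ring) (by simp; linarith)
  obtain ⟨hs1, hs0, -⟩ := key ![s 1, -s 0, 0] (by simp; linarith) (by simp; ring)
  simp only [Matrix.cons_val, neg_eq_zero] at hr0 hs0
  obtain ⟨h1, -⟩ := key ![1, 0, 0] (by simp [hr0]) (by simp [hs0])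
  simp at h1

lemma cartan_castLE {m : ℕ} (hm : 3 ≤ m) (i j : Fin 3) :
    cartan m (Fin.castLE hm i) (Fin.castLE hm j) = cartan 3 i j := by
  simp [cartan]

/-- For `m ≥ 3`, every `U_q(sl(m+1))`-module-algebra structure on the quantum plane
is given by signs on the generators, with all `e_i`, `f_i` vanishing. -/
theorem Uqsl_m_on_Aq2_trivial (q : ℂ) (hq : q ≠ 0)
    (hq' : ∀ N : ℕ, 0 < N → q ^ N ≠ 1)
    (m : ℕ) (hm : 3 ≤ m) (π : UqslMA q m (QSpace q 2)) (i : Fin m) :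
    ∃ ε₁ ε₂ : ℂ, (ε₁ = 1 ∨ ε₁ = -1) ∧ (ε₂ = 1 ∨ ε₂ = -1) ∧
      π.k i (P1 q) = ε₁ • P1 q ∧ π.k i (P2 q) = ε₂ • P2 q ∧
      π.e i (P1 q) = 0 ∧ π.e i (P2 q) = 0 ∧
      π.f i (P1 q) = 0 ∧ π.f i (P2 q) = 0 ∧
      (∀ a : QSpace q 2, π.e i a = 0) ∧ (∀ a : QSpace q 2, π.f i a = 0) := by
  have hq2 : q ^ 2 ≠ 1 := hq' 2 two_pos
  have hq4 : q ^ 4 ≠ 1 := hq' 4 (by norm_num)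
  choose α β hα hβ hk1 hk2 using fun j => algEquiv_diagonal hq hq' (π.k j)
  have kill_e (j l : Fin m) (hj : α j ^ 2 = 1 ∧ β j ^ 2 = 1) (hc : cartan m j l ≠ 0) :
      π.e l = 0 := by
    refine eq_zero_of_sign_weights (hk1 j) (hk2 j) (π.ke j l) hj.1 hj.2 fun h => hc ?_
    rw [← zpow_natCast, ← zpow_mul] at h
    have := eq_zero_of_zpow_eq_one hq' h
    push_cast at this
    omega
  have kill_f (j : Fin m) (hj : α j ^ 2 = 1 ∧ β j ^ 2 = 1) : π.f j = 0 := by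
    refine eq_zero_of_sign_weights (hk1 j) (hk2 j) (π.kf j j) hj.1 hj.2 fun h => ?_
    rw [← zpow_natCast, ← zpow_mul] at h
    have := eq_zero_of_zpow_eq_one hq' h
    simp [cartan] at this
  have sign (j : Fin m) (hj : π.e j = 0) : α j ^ 2 = 1 ∧ β j ^ 2 = 1 := by
    have hne : (q - q⁻¹)⁻¹ ≠ 0 := by
      refine inv_ne_zero fun h => hq2 ?_
      rw [sub_eq_zero] at h
      nth_rewrite 1 [pow_two, h]
      exact inv_mul_cancel₀ hq
    have hkk (a : QSpace q 2) : π.k j (π.k j a) = a := by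
      have h := π.ef j j a
      rw [if_pos rfl, hj] at h
      simp only [LinearMap.zero_apply, map_zero, sub_zero] at h
      rw [sub_eq_zero.1 ((smul_eq_zero.1 h.symm).resolve_left hne), AlgEquiv.apply_symm_apply]
    have h1 := hkk (P1 q)
    have h2 := hkk (P2 q)
    rw [hk1, map_smul, hk1, smul_smul, ← pow_two] at h1
    rw [hk2, map_smul, hk2, smul_smul, ← pow_two] at h2
    have b1 : P1 q = qmono q (1, 0) := by simp [qmono]
    have b2 : P2 q = qmono q (0, 1) := by simp [qmono]
    constructor
    · simpa [b1] using congrArg (fun w => (qbasis q).repr w (1, 0)) h1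
    · simpa [b2] using congrArg (fun w => (qbasis q).repr w (0, 1)) h2
  have start : ∃ j, π.e j = 0 := by
    by_contra! hne
    choose n l hnl using fun j => exists_repr_ne_zero (hne j)
    let ι := Fin.castLE hm
    refine not_cartan_weights hq hq' (α ∘ ι) (β ∘ ι) (fun _ => hα _) (fun _ => hβ _)
      (fun j => (l (ι j)).1 - (n (ι j)).1) (fun j => (l (ι j)).2 - (n (ι j)).2) fun i j => ?_
    have h := weight_eq (hk1 (ι i)) (hk2 (ι i)) (π.ke (ι i) (ι j)) (hnl (ι j))
    rw [cartan_castLE] at h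
    simp only [Function.comp_apply, zpow_sub₀ (hα _), zpow_sub₀ (hβ _), zpow_natCast]
    rw [div_mul_div_comm, h, mul_div_cancel_right₀]
    exact mul_ne_zero (pow_ne_zero _ (hα _)) (pow_ne_zero _ (hβ _))
  have step (a : ℕ) (ha : a + 1 < m) :
      π.e ⟨a, by omega⟩ = 0 ↔ π.e ⟨a + 1, ha⟩ = 0 :=
    ⟨fun h => kill_e _ _ (sign _ h) (by simp [cartan]),
      fun h => kill_e _ _ (sign _ h) (by simp [cartan])⟩
  have chain (a : ℕ) (ha : a < m) : π.e ⟨a, ha⟩ = 0 ↔ π.e ⟨0, by omega⟩ = 0 := by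
    induction a with
    | zero => rfl
    | succ a ih => rw [← step a ha, ih]
  obtain ⟨j, hj⟩ := start
  have he : π.e i = 0 := (chain i i.2).2 ((chain j j.2).1 hj)
  have hs := sign i he
  have hf := kill_f i hs
  exact ⟨α i, β i, by simpa using hs.1, by simpa using hs.2, hk1 i, hk2 i,
    by simp [he], by simp [he], by simp [hf], by simp [hf], by simp [he], by simp [hf]⟩
end
end

section
/- Let (k, k^{-1}, e, f) be a module-algebra structure of U_q(sl(2)) on the quantum 3-space A_q(3) with k(x_1) = q⁻²x_1, k(x_2) = q⁻¹x_2, k(x_3) = q⁻¹x_3. Then there exist a₀ ∈ ℂ∖{0} and ξ₁, ξ₂, ξ₃, ξ₄ ∈ ℂ such that e(x_1) = a₀·1, e(x_2) = e(x_3) = 0, f(x_1) = −qa₀⁻¹x_1², f(x_2) = −qa₀⁻¹x_1x_2 + ξ₁x_2x_3² + ξ₂x_2³ + ξ₃x_3³, and f(x_3) = −qa₀⁻¹x_1x_3 + ξ₄x_2x_3² + (1+q+q²)ξ₂x_2²x_3 − q⁻¹ξ₁x_3³. Conversely, for every such choice of a₀ ∈ ℂ∖{0} and ξ₁, ξ₂,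 ξ₃, ξ₄ ∈ ℂ these formulas (extended by the module-algebra conditions) define a module-algebra structure of U_q(sl(2)) on A_q(3). -/
noncomputable section

open scoped BigOperators

/-- The generator `x_1` of the quantum 3-space. -/
def Z1 (q : ℂ) : QSpace q 3 := Xg q 3 0
/-- The generator `x_2` of the quantum 3-space. -/
def Z2 (q : ℂ) : QSpace q 3 := Xg q 3 1
/-- The generator `x_3` of the quantum 3-space. -/
def Z3 (q : ℂ) : QSpace q 3 := Xg q 3 2

/-- The description of the `U_q(sl(2))`-actions on `A_q(3)` of Lemma 4.3 (case `(∗₂)`). -/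
def Desc4 (q : ℂ) (π : UqslMA q 1 (QSpace q 3)) (a₀ ξ₁ ξ₂ ξ₃ ξ₄ : ℂ) : Prop :=
  π.k 0 (Z1 q) = (q ^ (-2 : ℤ)) • Z1 q ∧
  π.k 0 (Z2 q) = q⁻¹ • Z2 q ∧
  π.k 0 (Z3 q) = q⁻¹ • Z3 q ∧
  π.e 0 (Z1 q) = a₀ • 1 ∧ π.e 0 (Z2 q) = 0 ∧ π.e 0 (Z3 q) = 0 ∧
  π.f 0 (Z1 q) = (-q * a₀⁻¹) • (Z1 q ^ 2) ∧
  π.f 0 (Z2 q) = (-q * a₀⁻¹) • (Z1 q * Z2 q) + ξ₁ • (Z2 q * Z3 q ^ 2)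
      + ξ₂ • (Z2 q ^ 3) + ξ₃ • (Z3 q ^ 3) ∧
  π.f 0 (Z3 q) = (-q * a₀⁻¹) • (Z1 q * Z3 q) + ξ₄ • (Z2 q * Z3 q ^ 2)
      + ((1 + q + q ^ 2) * ξ₂) • (Z2 q ^ 2 * Z3 q) - (q⁻¹ * ξ₁) • (Z3 q ^ 3)

namespace QSpace

theorem induction_on {q : ℂ} {n : ℕ} {P : QSpace q n → Prop}
    (scalar : ∀ r : ℂ, P (algebraMap ℂ _ r)) (gen : ∀ i, P (Xg q n i))
    (add : ∀ a b, P a → P b → P (a + b)) (mul : ∀ a b, P a → P b → P (a * b))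
    (a : QSpace q n) : P a := by
  obtain ⟨a, rfl⟩ := RingQuot.mkAlgHom_surjective ℂ (QRel q n) a
  induction a using FreeAlgebra.induction with
  | grade0 r => simpa using scalar r
  | grade1 i => exact gen i
  | mul a b ha hb => rw [map_mul]; exact mul _ _ ha hb
  | add a b ha hb => rw [map_add]; exact add _ _ ha hb

theorem Xg_mul_Xg (q : ℂ) {n : ℕ} {i j : Fin n} (h : j < i) :
    Xg q n i * Xg q n j = q • (Xg q n j * Xg q n i) := by
  have := RingQuot.mkAlgHom_rel ℂ (QRel.rel (q := q) i j h)
  simpa [Xg] using this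

/-- The algebra homomorphism out of the quantum space determined by `q`-commuting elements. -/
def lift {q : ℂ} {n : ℕ} {B : Type*} [Ring B] [Algebra ℂ B] (y : Fin n → B)
    (h : ∀ i j, j < i → y i * y j = q • (y j * y i)) : QSpace q n →ₐ[ℂ] B :=
  RingQuot.liftAlgHom ℂ ⟨FreeAlgebra.lift ℂ y, by
    rintro _ _ ⟨i, j, hij⟩
    simpa using h i j hij⟩

@[simp]
theorem lift_Xg {q : ℂ} {n : ℕ} {B : Type*} [Ring B] [Algebra ℂ B] (y : Fin n → B)
    (h : ∀ i j, j < i → y i * y j = q • (y j * y i)) (i : Fin n) :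
    lift y h (Xg q n i) = y i := by
  simp [lift, Xg]

/-- Twisted derivations which agree on the generators are equal. -/
theorem twistedDerivation_ext {q : ℂ} {n : ℕ} (σ τ : QSpace q n → QSpace q n)
    (D D' : QSpace q n →ₗ[ℂ] QSpace q n) (h1 : D 1 = D' 1)
    (hD : ∀ a b, D (a * b) = σ a * D b + D a * τ b)
    (hD' : ∀ a b, D' (a * b) = σ a * D' b + D' a * τ b)
    (h : ∀ i, D (Xg q n i) = D' (Xg q n i)) (a : QSpace q n) : D a = D' a := by
  induction a using induction_on with
  | scalar r => rw [Algebra.algebraMap_eq_smul_one, map_smul, map_smul, h1]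
  | gen i => exact h i
  | add a b ha hb => rw [map_add, map_add, ha, hb]
  | mul a b ha hb => rw [hD, hD', ha, hb]

/-- A twisted derivation with prescribed values on the generators exists as soon as the values
are compatible with the defining relations. -/
theorem exists_twistedDerivation {q : ℂ} {n : ℕ} (σ τ : QSpace q n →ₐ[ℂ] QSpace q n)
    (d : Fin n → QSpace q n)
    (hd : ∀ i j, j < i → σ (Xg q n i) * d j + d i * τ (Xg q n j) =
      q • (σ (Xg q n j) * d i + d j * τ (Xg q n i))) :
    ∃ D : QSpace q n →ₗ[ℂ] QSpace q n, D 1 = 0 ∧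
      (∀ a b, D (a * b) = σ a * D b + D a * τ b) ∧ ∀ i, D (Xg q n i) = d i := by
  let M : QSpace q n →ₐ[ℂ] Matrix (Fin 2) (Fin 2) (QSpace q n) :=
    lift (fun i => !![σ (Xg q n i), d i; 0, τ (Xg q n i)]) (by
      intro i j hij
      have hσ := congrArg σ (Xg_mul_Xg q hij)
      have hτ := congrArg τ (Xg_mul_Xg q hij)
      simp only [map_mul, map_smul] at hσ hτ
      simp only [Matrix.mul_fin_two, mul_zero, zero_mul, add_zero, zero_add,
        Matrix.smul_of, Matrix.smul_cons, Matrix.smul_empty, smul_zero, hσ, hτ, hd i j hij])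
  have hM : ∀ a, M a 0 0 = σ a ∧ M a 1 0 = 0 ∧ M a 1 1 = τ a := by
    intro a
    induction a using induction_on with
    | scalar r => simp [Matrix.algebraMap_matrix_apply]
    | gen i => simp [M]
    | add a b ha hb => simp [ha, hb]
    | mul a b ha hb => simp [Matrix.mul_apply, ha, hb]
  refine ⟨{ toFun := fun a => M a 0 1, map_add' := by simp, map_smul' := by simp }, ?_, ?_, ?_⟩
  · simp
  · intro a b
    simp [Matrix.mul_apply, hM]
  · intro i
    simp [M]

end QSpace

section QuantumThreeSpace

variable (q : ℂ)

theorem Z2_mul_Z1 : Z2 q * Z1 q = q • (Z1 q * Z2 q) := QSpace.Xg_mul_Xg q (by decide)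

theorem Z3_mul_Z1 : Z3 q * Z1 q = q • (Z1 q * Z3 q) := QSpace.Xg_mul_Xg q (by decide)

theorem Z3_mul_Z2 : Z3 q * Z2 q = q • (Z2 q * Z3 q) := QSpace.Xg_mul_Xg q (by decide)

theorem Z2_mul_Z1_mul (y : QSpace q 3) : Z2 q * (Z1 q * y) = q • (Z1 q * (Z2 q * y)) := by
  rw [← mul_assoc, Z2_mul_Z1, smul_mul_assoc, mul_assoc]

theorem Z3_mul_Z1_mul (y : QSpace q 3) : Z3 q * (Z1 q * y) = q • (Z1 q * (Z3 q * y)) := by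
  rw [← mul_assoc, Z3_mul_Z1, smul_mul_assoc, mul_assoc]

theorem Z3_mul_Z2_mul (y : QSpace q 3) : Z3 q * (Z2 q * y) = q • (Z2 q * (Z3 q * y)) := by
  rw [← mul_assoc, Z3_mul_Z2, smul_mul_assoc, mul_assoc]

/-- The vector space with basis indexed by the exponents of the ordered monomials. -/
abbrev ExpSpace : Type := ℕ × ℕ × ℕ →₀ ℂ

/-- The left multiplication operators by the generators, in the basis of ordered monomials. -/
def leftMulGen : Fin 3 → Module.End ℂ ExpSpace :=
  ![Finsupp.linearCombination ℂ fun m => Finsupp.single (m.1 + 1, m.2.1, m.2.2) 1,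
    Finsupp.linearCombination ℂ fun m => Finsupp.single (m.1, m.2.1 + 1, m.2.2) (q ^ m.1),
    Finsupp.linearCombination ℂ fun m =>
      Finsupp.single (m.1, m.2.1, m.2.2 + 1) (q ^ (m.1 + m.2.1))]

/-- The left regular representation in the basis of ordered monomials. -/
def leftReg : QSpace q 3 →ₐ[ℂ] Module.End ℂ ExpSpace :=
  QSpace.lift (leftMulGen q) (by
    intro i j hij
    ext ⟨a, b, c⟩ : 2
    ext m : 1
    fin_cases i <;> fin_cases j <;> first
      | exact absurd hij (by decide)
      | (simp [leftMulGen, Finsupp.linearCombination_single, Finsupp.single_apply]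
         grind))

/-- The coordinates of an element with respect to the ordered monomials. -/
def coords : QSpace q 3 →ₗ[ℂ] ExpSpace :=
  LinearMap.applyₗ (Finsupp.single (0, 0, 0) 1) ∘ₗ (leftReg q).toLinearMap

/-- The linear combination of ordered monomials with given coordinates. -/
def ofCoords : ExpSpace →ₗ[ℂ] QSpace q 3 :=
  Finsupp.linearCombination ℂ fun m => Z1 q ^ m.1 * (Z2 q ^ m.2.1 * Z3 q ^ m.2.2)

theorem ofCoords_single (a b c : ℕ) (r : ℂ) :
    ofCoords q (Finsupp.single (a, b, c) r) = r • (Z1 q ^ a * (Z2 q ^ b * Z3 q ^ c)) := by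
  rw [ofCoords, Finsupp.linearCombination_single]

theorem coords_one : coords q 1 = Finsupp.single (0, 0, 0) 1 := by simp [coords]

theorem coords_mul (a b : QSpace q 3) : coords q (a * b) = leftReg q a (coords q b) := by
  simp [coords]

theorem leftReg_Z1 (a b c : ℕ) (r : ℂ) : leftReg q (Z1 q) (Finsupp.single (a, b, c) r) =
    Finsupp.single (a + 1, b, c) r := by
  simp [leftReg, leftMulGen, Z1, Finsupp.linearCombination_single]

theorem leftReg_Z2 (a b c : ℕ) (r : ℂ) : leftReg q (Z2 q) (Finsupp.single (a, b, c) r) =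
    Finsupp.single (a, b + 1, c) (r * q ^ a) := by
  simp [leftReg, leftMulGen, Z2, Finsupp.linearCombination_single]

theorem leftReg_Z3 (a b c : ℕ) (r : ℂ) : leftReg q (Z3 q) (Finsupp.single (a, b, c) r) =
    Finsupp.single (a, b, c + 1) (r * q ^ (a + b)) := by
  simp [leftReg, leftMulGen, Z3, Finsupp.linearCombination_single]

theorem coords_Z1 : coords q (Z1 q) = Finsupp.single (1, 0, 0) 1 := by
  rw [← mul_one (Z1 q), coords_mul, coords_one, leftReg_Z1]

theorem coords_Z2 : coords q (Z2 q) = Finsupp.single (0, 1, 0) 1 := by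
  rw [← mul_one (Z2 q), coords_mul, coords_one, leftReg_Z2]; simp

theorem coords_Z3 : coords q (Z3 q) = Finsupp.single (0, 0, 1) 1 := by
  rw [← mul_one (Z3 q), coords_mul, coords_one, leftReg_Z3]; simp

theorem leftReg_Z1_pow (n a b c : ℕ) (r : ℂ) :
    leftReg q (Z1 q ^ n) (Finsupp.single (a, b, c) r) = Finsupp.single (a + n, b, c) r := by
  induction n with
  | zero => simp
  | succ n ih => rw [pow_succ', map_mul, Module.End.mul_apply, ih, leftReg_Z1, add_assoc]

theorem leftReg_Z2_pow (n b c : ℕ) (r : ℂ) :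
    leftReg q (Z2 q ^ n) (Finsupp.single (0, b, c) r) = Finsupp.single (0, b + n, c) r := by
  induction n with
  | zero => simp
  | succ n ih =>
    rw [pow_succ', map_mul, Module.End.mul_apply, ih, leftReg_Z2, add_assoc, pow_zero, mul_one]

theorem leftReg_Z3_pow (n c : ℕ) (r : ℂ) :
    leftReg q (Z3 q ^ n) (Finsupp.single (0, 0, c) r) = Finsupp.single (0, 0, c + n) r := by
  induction n with
  | zero => simp
  | succ n ih =>
    rw [pow_succ', map_mul, Module.End.mul_apply, ih, leftReg_Z3, add_assoc, add_zero, pow_zero,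
      mul_one]

theorem coords_monomial (a b c : ℕ) :
    coords q (Z1 q ^ a * (Z2 q ^ b * Z3 q ^ c)) = Finsupp.single (a, b, c) 1 := by
  rw [← mul_one (Z3 q ^ c), coords_mul, coords_mul, coords_mul, coords_one, leftReg_Z3_pow,
    leftReg_Z2_pow, leftReg_Z1_pow]
  simp

theorem Z2_mul_Z1_pow_mul (n : ℕ) (y : QSpace q 3) :
    Z2 q * (Z1 q ^ n * y) = q ^ n • (Z1 q ^ n * (Z2 q * y)) := by
  induction n with
  | zero => simp
  | succ n ih => rw [pow_succ', mul_assoc, Z2_mul_Z1_mul, ih, mul_smul_comm, smul_smul,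
      mul_assoc, pow_succ']

theorem Z3_mul_Z1_pow_mul (n : ℕ) (y : QSpace q 3) :
    Z3 q * (Z1 q ^ n * y) = q ^ n • (Z1 q ^ n * (Z3 q * y)) := by
  induction n with
  | zero => simp
  | succ n ih => rw [pow_succ', mul_assoc, Z3_mul_Z1_mul, ih, mul_smul_comm, smul_smul,
      mul_assoc, pow_succ']

theorem Z3_mul_Z2_pow_mul (n : ℕ) (y : QSpace q 3) :
    Z3 q * (Z2 q ^ n * y) = q ^ n • (Z2 q ^ n * (Z3 q * y)) := by
  induction n with
  | zero => simp
  | succ n ih => rw [pow_succ', mul_assoc, Z3_mul_Z2_mul, ih, mul_smul_comm, smul_smul,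
      mul_assoc, pow_succ']

theorem ofCoords_leftReg (a : QSpace q 3) (v : ExpSpace) :
    ofCoords q (leftReg q a v) = a * ofCoords q v := by
  induction a using QSpace.induction_on generalizing v with
  | scalar r => simp [Algebra.algebraMap_eq_smul_one]
  | add a b ha hb => simp [ha, hb, add_mul]
  | mul a b ha hb => simp [ha, hb, mul_assoc]
  | gen i =>
    induction v using Finsupp.induction_linear with
    | zero => simp
    | add v w hv hw => simp [hv, hw, mul_add]
    | single m r =>
      obtain ⟨a, b, c⟩ := m
      fin_cases i
      · change ofCoords q (leftReg q (Z1 q) _) = Z1 q * _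
        rw [leftReg_Z1, ofCoords_single, ofCoords_single, mul_smul_comm, pow_succ', mul_assoc]
      · change ofCoords q (leftReg q (Z2 q) _) = Z2 q * _
        rw [leftReg_Z2, ofCoords_single, ofCoords_single, mul_smul_comm, Z2_mul_Z1_pow_mul,
          pow_succ' (Z2 q), mul_assoc, smul_smul]
      · change ofCoords q (leftReg q (Z3 q) _) = Z3 q * _
        rw [leftReg_Z3, ofCoords_single, ofCoords_single, mul_smul_comm, Z3_mul_Z1_pow_mul,
          Z3_mul_Z2_pow_mul, pow_succ' (Z3 q), mul_smul_comm, smul_smul, smul_smul, pow_add,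
          mul_assoc]

theorem ofCoords_coords (a : QSpace q 3) : ofCoords q (coords q a) = a := by
  rw [coords, LinearMap.comp_apply, LinearMap.applyₗ_apply_apply, AlgHom.toLinearMap_apply,
    ofCoords_leftReg, ofCoords_single]
  simp

theorem coords_ofCoords (v : ExpSpace) : coords q (ofCoords q v) = v := by
  induction v using Finsupp.induction_linear with
  | zero => rw [map_zero, map_zero]
  | add v w hv hw => simp [hv, hw]
  | single m r =>
    obtain ⟨a, b, c⟩ := m
    simp [ofCoords_single, coords_monomial]

variable {q}

theorem eq_sum_of_coords_eq_zero {y : QSpace q 3} (s : Finset (ℕ × ℕ × ℕ))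
    (h : ∀ m ∉ s, coords q y m = 0) :
    y = ∑ m ∈ s, coords q y m • (Z1 q ^ m.1 * (Z2 q ^ m.2.1 * Z3 q ^ m.2.2)) := by
  conv_lhs => rw [← ofCoords_coords q y, ofCoords, Finsupp.linearCombination_apply]
  refine Finsupp.sum_of_support_subset _ (fun m hm => ?_) _ (by simp)
  by_contra hms
  exact Finsupp.mem_support_iff.1 hm (h m hms)

theorem coords_weight {k : QSpace q 3 ≃ₐ[ℂ] QSpace q 3}
    (h1 : k (Z1 q) = (q ^ (-2 : ℤ)) • Z1 q) (h2 : k (Z2 q) = q⁻¹ • Z2 q)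
    (h3 : k (Z3 q) = q⁻¹ • Z3 q) (y : QSpace q 3) (m : ℕ × ℕ × ℕ) :
    coords q (k y) m = q⁻¹ ^ (2 * m.1 + m.2.1 + m.2.2) * coords q y m := by
  rw [← ofCoords_coords q y]
  generalize coords q y = v
  rw [coords_ofCoords]
  induction v using Finsupp.induction_linear with
  | zero => simp
  | add v w hv hw => simp [hv, hw, mul_add]
  | single n r =>
    obtain ⟨a, b, c⟩ := n
    have : k (ofCoords q (Finsupp.single (a, b, c) r)) =
        q⁻¹ ^ (2 * a + b + c) • ofCoords q (Finsupp.single (a, b, c) r) := by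
      rw [ofCoords_single, map_smul, map_mul, map_mul, map_pow, map_pow, map_pow, h1, h2, h3]
      simp only [smul_pow, smul_mul_assoc, mul_smul_comm, smul_smul]
      congr 1
      simp only [zpow_neg, zpow_ofNat, pow_add, pow_mul, inv_pow]
      ring
    rw [this, map_smul, coords_ofCoords, Finsupp.smul_apply, smul_eq_mul]
    by_cases hm : (a, b, c) = m
    · subst hm; simp
    · simp [hm]

theorem zpow_ne_one_of_pow_ne_one (hq' : ∀ N : ℕ, 0 < N → q ^ N ≠ 1) {z : ℤ} (hz : z ≠ 0) :
    q ^ z ≠ 1 := by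
  intro h
  refine hq' z.natAbs (Int.natAbs_pos.2 hz) ?_
  rcases Int.natAbs_eq z with h' | h'
  · rwa [h', zpow_natCast] at h
  · rwa [h', zpow_neg, zpow_natCast, inv_eq_one] at h

theorem coords_eq_zero_of_weight_ne (hq : q ≠ 0) (hq' : ∀ N : ℕ, 0 < N → q ^ N ≠ 1)
    {k : QSpace q 3 ≃ₐ[ℂ] QSpace q 3}
    (h1 : k (Z1 q) = (q ^ (-2 : ℤ)) • Z1 q) (h2 : k (Z2 q) = q⁻¹ • Z2 q)
    (h3 : k (Z3 q) = q⁻¹ • Z3 q) {y : QSpace q 3} {n : ℤ} (hy : k y = q ^ (-n) • y)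
    {m : ℕ × ℕ × ℕ} (hm : ((2 * m.1 + m.2.1 + m.2.2 : ℕ) : ℤ) ≠ n) : coords q y m = 0 := by
  have h := coords_weight h1 h2 h3 y m
  rw [hy, map_smul, Finsupp.smul_apply, smul_eq_mul] at h
  by_contra hne
  have h' := mul_right_cancel₀ hne h
  refine zpow_ne_one_of_pow_ne_one hq' (sub_ne_zero.2 hm) ?_
  rw [inv_pow, zpow_neg, inv_inj] at h'
  rw [zpow_sub₀ hq, zpow_natCast, h', div_self (pow_ne_zero _ hq)]

theorem exists_smul_one_of_weight_zero (hq : q ≠ 0) (hq' : ∀ N : ℕ, 0 < N → q ^ N ≠ 1)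
    {k : QSpace q 3 ≃ₐ[ℂ] QSpace q 3}
    (h1 : k (Z1 q) = (q ^ (-2 : ℤ)) • Z1 q) (h2 : k (Z2 q) = q⁻¹ • Z2 q)
    (h3 : k (Z3 q) = q⁻¹ • Z3 q) {y : QSpace q 3} (hy : k y = y) :
    ∃ c : ℂ, y = c • 1 := by
  have h := eq_sum_of_coords_eq_zero (y := y) {(0, 0, 0)} (by
    rintro ⟨a, b, c⟩ hm
    refine coords_eq_zero_of_weight_ne (n := 0) hq hq' h1 h2 h3 (by simpa using hy) ?_
    simp at hm ⊢
    omega)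
  exact ⟨_, by simpa using h⟩

theorem exists_eq_of_weight_three (hq : q ≠ 0) (hq' : ∀ N : ℕ, 0 < N → q ^ N ≠ 1)
    {k : QSpace q 3 ≃ₐ[ℂ] QSpace q 3}
    (h1 : k (Z1 q) = (q ^ (-2 : ℤ)) • Z1 q) (h2 : k (Z2 q) = q⁻¹ • Z2 q)
    (h3 : k (Z3 q) = q⁻¹ • Z3 q) {y : QSpace q 3} (hy : k y = q ^ (-3 : ℤ) • y) :
    ∃ b₁ b₂ p₀ p₁ p₂ p₃ : ℂ, y = b₁ • (Z1 q * Z2 q) + b₂ • (Z1 q * Z3 q) + p₀ • Z3 q ^ 3 +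
      p₁ • (Z2 q * Z3 q ^ 2) + p₂ • (Z2 q ^ 2 * Z3 q) + p₃ • Z2 q ^ 3 := by
  have h := eq_sum_of_coords_eq_zero (y := y)
    {(1, 1, 0), (1, 0, 1), (0, 0, 3), (0, 1, 2), (0, 2, 1), (0, 3, 0)} (by
    rintro ⟨a, b, c⟩ hm
    refine coords_eq_zero_of_weight_ne hq hq' h1 h2 h3 hy ?_
    simp at hm ⊢
    omega)
  exact ⟨_, _, _, _, _, _, by simpa [add_assoc] using h⟩

theorem exists_eq_of_weight_four (hq : q ≠ 0) (hq' : ∀ N : ℕ, 0 < N → q ^ N ≠ 1)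
    {k : QSpace q 3 ≃ₐ[ℂ] QSpace q 3}
    (h1 : k (Z1 q) = (q ^ (-2 : ℤ)) • Z1 q) (h2 : k (Z2 q) = q⁻¹ • Z2 q)
    (h3 : k (Z3 q) = q⁻¹ • Z3 q) {y : QSpace q 3} (hy : k y = q ^ (-4 : ℤ) • y) :
    ∃ α b₁ b₂ b₃ p₀ p₁ p₂ p₃ p₄ : ℂ, y = α • Z1 q ^ 2 + b₁ • (Z1 q * Z2 q ^ 2) +
      b₂ • (Z1 q * (Z2 q * Z3 q)) + b₃ • (Z1 q * Z3 q ^ 2) + p₀ • Z3 q ^ 4 +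
      p₁ • (Z2 q * Z3 q ^ 3) + p₂ • (Z2 q ^ 2 * Z3 q ^ 2) + p₃ • (Z2 q ^ 3 * Z3 q) +
      p₄ • Z2 q ^ 4 := by
  have h := eq_sum_of_coords_eq_zero (y := y)
    {(2, 0, 0), (1, 2, 0), (1, 1, 1), (1, 0, 2), (0, 0, 4), (0, 1, 3), (0, 2, 2), (0, 3, 1),
      (0, 4, 0)} (by
    rintro ⟨a, b, c⟩ hm
    refine coords_eq_zero_of_weight_ne hq hq' h1 h2 h3 hy fun hw => ?_
    obtain rfl : c = 4 - 2 * a - b := by dsimp only at hw; omega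
    have ha : a ≤ 2 := by dsimp only at hw; omega
    have hb : b ≤ 4 := by dsimp only at hw; omega
    interval_cases a <;> interval_cases b <;> first
      | exact absurd hw (by decide)
      | exact hm (by decide))
  exact ⟨_, _, _, _, _, _, _, _, _, by simpa [add_assoc] using h⟩

theorem exists_desc4 (hq : q ≠ 0) (hq' : ∀ N : ℕ, 0 < N → q ^ N ≠ 1)
    (π : UqslMA q 1 (QSpace q 3)) (h1 : π.k 0 (Z1 q) = (q ^ (-2 : ℤ)) • Z1 q)
    (h2 : π.k 0 (Z2 q) = q⁻¹ • Z2 q) (h3 : π.k 0 (Z3 q) = q⁻¹ • Z3 q) :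
    ∃ a₀ ξ₁ ξ₂ ξ₃ ξ₄ : ℂ, a₀ ≠ 0 ∧ Desc4 q π a₀ ξ₁ ξ₂ ξ₃ ξ₄ := by
  have hsymm : ∀ {y : QSpace q 3} {r : ℂ}, r ≠ 0 → π.k 0 y = r⁻¹ • y →
      (π.k 0).symm y = r • y := by
    intro y r hr h
    rw [AlgEquiv.symm_apply_eq, map_smul, h, smul_smul, mul_inv_cancel₀ hr, one_smul]
  have s1 : (π.k 0).symm (Z1 q) = q ^ 2 • Z1 q :=
    hsymm (pow_ne_zero 2 hq) (by rw [h1, zpow_neg]; rfl)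
  have s2 : (π.k 0).symm (Z2 q) = q • Z2 q := hsymm hq h2
  have s3 : (π.k 0).symm (Z3 q) = q • Z3 q := hsymm hq h3
  have ke : ∀ a, π.k 0 (π.e 0 a) = q ^ (2 : ℤ) • π.e 0 (π.k 0 a) := by
    intro a
    simpa [cartan] using π.ke 0 0 (π.k 0 a)
  have kf : ∀ a, π.k 0 (π.f 0 a) = q ^ (-2 : ℤ) • π.f 0 (π.k 0 a) := by
    intro a
    simpa [cartan] using π.kf 0 0 (π.k 0 a)
  have ef : ∀ a, π.e 0 (π.f 0 a) - π.f 0 (π.e 0 a) =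
      (q - q⁻¹)⁻¹ • (π.k 0 a - (π.k 0).symm a) := by
    intro a
    simpa using π.ef 0 0 a
  have e_zero : ∀ y, π.k 0 y = q⁻¹ • y → π.e 0 y = 0 := by
    intro y hy
    have h := ke y
    rw [hy, map_smul, smul_smul] at h
    rw [← ofCoords_coords q (π.e 0 y), ← map_zero (ofCoords q)]
    congr 1
    ext m
    refine coords_eq_zero_of_weight_ne (n := -1) hq hq' h1 h2 h3 (h.trans ?_) (by omega)
    congr 1
    rw [neg_neg, zpow_one, zpow_ofNat]
    field_simp
  have e2 : π.e 0 (Z2 q) = 0 := e_zero _ h2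
  have e3 : π.e 0 (Z3 q) = 0 := e_zero _ h3
  obtain ⟨a₀, e1⟩ : ∃ c : ℂ, π.e 0 (Z1 q) = c • 1 := by
    refine exists_smul_one_of_weight_zero hq hq' h1 h2 h3 ?_
    rw [ke, h1, map_smul, smul_smul, ← zpow_add₀ hq]
    simp
  have f_weight : ∀ y, π.k 0 y = q⁻¹ • y → π.k 0 (π.f 0 y) = q ^ (-3 : ℤ) • π.f 0 y := by
    intro y hy
    rw [kf, hy, map_smul, smul_smul, ← zpow_neg_one, ← zpow_add₀ hq]
    norm_num
  obtain ⟨α, β₁, β₂, β₃, δ₀, δ₁, δ₂, δ₃, δ₄, f1⟩ : ∃ α b₁ b₂ b₃ p₀ p₁ p₂ p₃ p₄ : ℂ, _ :=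
    exists_eq_of_weight_four (y := π.f 0 (Z1 q)) hq hq' h1 h2 h3 (by
      rw [kf, h1, map_smul, smul_smul, ← zpow_add₀ hq]
      norm_num)
  obtain ⟨b, b', p₀, p₁, p₂, p₃, f2⟩ :=
    exists_eq_of_weight_three hq hq' h1 h2 h3 (f_weight _ h2)
  obtain ⟨c', c, r₀, r₁, r₂, r₃, f3⟩ :=
    exists_eq_of_weight_three hq hq' h1 h2 h3 (f_weight _ h3)
  have E1 := ef (Z1 q)
  have E2 := ef (Z2 q)
  have E3 := ef (Z3 q)
  have R21 := congrArg (π.f 0) (Z2_mul_Z1 q)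
  have R31 := congrArg (π.f 0) (Z3_mul_Z1 q)
  have R32 := congrArg (π.f 0) (Z3_mul_Z2 q)
  simp only [f1, f2, f3, e1, e2, e3, h1, h2, h3, s1, s2, s3, π.e_mul, π.f_mul, π.f_one,
    map_add, map_smul, map_mul, map_zero, pow_succ, pow_zero, one_mul, mul_zero, zero_mul,
    smul_zero, add_zero, zero_add, mul_add, add_mul, smul_add, smul_smul, mul_smul_comm,
    smul_mul_assoc, mul_one, mul_assoc, sub_zero, smul_sub] at E1 E2 E3 R21 R31 R32
  replace E1 := congrArg (coords q) E1
  replace E2 := congrArg (coords q) E2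
  replace E3 := congrArg (coords q) E3
  replace R21 := congrArg (coords q) R21
  replace R31 := congrArg (coords q) R31
  replace R32 := congrArg (coords q) R32
  simp only [map_add, map_sub, map_smul, coords_mul, coords_Z1, coords_Z2,
    coords_Z3, leftReg_Z1, leftReg_Z2, leftReg_Z3, zero_add, Finsupp.smul_single, smul_eq_mul,
    Nat.reduceAdd, pow_zero, pow_one, one_mul, mul_one] at E1 E2 E3 R21 R31 R32
  have E1a := DFunLike.congr_fun E1 (1, 0, 0)
  have E1b := DFunLike.congr_fun E1 (0, 2, 0)
  have E1c := DFunLike.congr_fun E1 (0, 1, 1)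
  have E1d := DFunLike.congr_fun E1 (0, 0, 2)
  have E2a := DFunLike.congr_fun E2 (0, 1, 0)
  have E2b := DFunLike.congr_fun E2 (0, 0, 1)
  have E3a := DFunLike.congr_fun E3 (0, 1, 0)
  have E3b := DFunLike.congr_fun E3 (0, 0, 1)
  have D0 := DFunLike.congr_fun R21 (0, 1, 4)
  have D1 := DFunLike.congr_fun R21 (0, 2, 3)
  have D2 := DFunLike.congr_fun R21 (0, 3, 2)
  have D3 := DFunLike.congr_fun R21 (0, 4, 1)
  have D4 := DFunLike.congr_fun R31 (0, 4, 1)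
  have P1 := DFunLike.congr_fun R32 (0, 1, 3)
  have P2 := DFunLike.congr_fun R32 (0, 2, 2)
  have P3 := DFunLike.congr_fun R32 (0, 3, 1)
  have P4 := DFunLike.congr_fun R32 (0, 4, 0)
  simp at E1a E1b E1c E1d E2a E2b E3a E3b D0 D1 D2 D3 D4 P1 P2 P3 P4
  clear E1 E2 E3 R21 R31 R32
  have q1 : q - 1 ≠ 0 := sub_ne_zero.2 (by simpa using hq' 1 one_pos)
  have q2 : q ^ 2 - 1 ≠ 0 := sub_ne_zero.2 (hq' 2 two_pos)
  have q3 : q ^ 3 - 1 ≠ 0 := sub_ne_zero.2 (hq' 3 three_pos)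
  have q4 : q ^ 4 - 1 ≠ 0 := sub_ne_zero.2 (hq' 4 four_pos)
  have qq : q - q⁻¹ ≠ 0 := by
    intro h
    apply q2
    field_simp at h
    linear_combination h
  have E2a' : b * a₀ = -q := by
    rw [← mul_sub, ← neg_sub q, mul_neg, inv_mul_cancel₀ qq] at E2a
    field_simp at E2a
    linear_combination E2a
  have E3b' : c * a₀ = -q := by
    rw [← mul_sub, ← neg_sub q, mul_neg, inv_mul_cancel₀ qq] at E3b
    field_simp at E3b
    linear_combination E3b
  have ha : a₀ ≠ 0 := by
    rintro rfl
    exact hq (by linear_combination E2a')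
  have hα : α = -q * a₀⁻¹ := by
    have q2' : q ^ 2 + 1 ≠ 0 := fun h => q4 (by linear_combination (q ^ 2 - 1) * h)
    have h : (q - q⁻¹)⁻¹ * (q ^ 2)⁻¹ - (q - q⁻¹)⁻¹ * (q * q) = -(q + q⁻¹) := by
      rw [← mul_sub, inv_mul_eq_iff_eq_mul₀ qq]
      field_simp
      ring
    rw [h] at E1a
    rw [eq_mul_inv_iff_mul_eq₀ ha]
    apply mul_right_cancel₀ q2'
    have hi : q * q⁻¹ = 1 := mul_inv_cancel₀ hq
    linear_combination q ^ 2 * E1a - (α * a₀ * (q * q⁻¹ + 1) + q) * hi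
  have hb : b = -q * a₀⁻¹ := by rw [← E2a', mul_inv_cancel_right₀ ha]
  have hc : c = -q * a₀⁻¹ := by rw [← E3b', mul_inv_cancel_right₀ ha]
  have z1 : β₁ = 0 := by simpa [hq, ha] using E1b
  have z2 : β₂ = 0 := by simpa [hq, ha] using E1c
  have z3 : β₃ = 0 := by simpa [hq, ha] using E1d
  have z4 : b' = 0 := by simpa [hq, ha] using E2b
  have z5 : c' = 0 := by simpa [hq, ha] using E3a
  have d0 : δ₀ = 0 :=
    (mul_eq_zero.1 (by linear_combination -D0 : q * (q ^ 4 - 1) * δ₀ = 0)).resolve_left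
      (mul_ne_zero hq q4)
  have d1 : δ₁ = 0 :=
    (mul_eq_zero.1 (by linear_combination -D1 : q * (q ^ 3 - 1) * δ₁ = 0)).resolve_left
      (mul_ne_zero hq q3)
  have d2 : δ₂ = 0 :=
    (mul_eq_zero.1 (by linear_combination -D2 : q * (q ^ 2 - 1) * δ₂ = 0)).resolve_left
      (mul_ne_zero hq q2)
  have d3 : δ₃ = 0 :=
    (mul_eq_zero.1 (by linear_combination -(D3.resolve_right hq) : (q - 1) * δ₃ = 0)).resolve_left
      q1
  have d4 : δ₄ = 0 :=
    (mul_eq_zero.1 (by linear_combination D4 : q * (q ^ 4 - 1) * δ₄ = 0)).resolve_left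
      (mul_ne_zero hq q4)
  have hr₀ : r₀ = -(q⁻¹ * p₁) := by
    field_simp
    apply mul_left_cancel₀ (mul_ne_zero hq q1)
    linear_combination P1
  have hp₂ : p₂ = 0 :=
    (mul_eq_zero.1 (by linear_combination P2 : q * (q ^ 2 - 1) * p₂ = 0)).resolve_left
      (mul_ne_zero hq q2)
  have hr₂ : r₂ = (1 + q + q ^ 2) * p₃ := by
    apply mul_left_cancel₀ (mul_ne_zero hq q1)
    linear_combination -P3
  have hr₃ : r₃ = 0 :=
    (mul_eq_zero.1 (by linear_combination -P4 : (q ^ 2 - 1) * r₃ = 0)).resolve_left q2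
  subst hα hb hc z1 z2 z3 z4 z5 d0 d1 d2 d3 d4 hr₀ hp₂ hr₂ hr₃
  refine ⟨a₀, p₁, p₃, p₀, r₁, ha, h1, h2, h3, e1, e2, e3, ?_, ?_, ?_⟩
  · rw [f1]; module
  · rw [f2]; module
  · rw [f3]; module

theorem algHom_ext_Z {B : Type*} [Ring B] [Algebra ℂ B] {φ ψ : QSpace q 3 →ₐ[ℂ] B}
    (h1 : φ (Z1 q) = ψ (Z1 q)) (h2 : φ (Z2 q) = ψ (Z2 q)) (h3 : φ (Z3 q) = ψ (Z3 q)) :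
    φ = ψ := by
  refine AlgHom.ext fun a => ?_
  induction a using QSpace.induction_on with
  | scalar r => simp
  | gen i => fin_cases i <;> assumption
  | add a b ha hb => simp [ha, hb]
  | mul a b ha hb => simp [ha, hb]

theorem twistedDerivation_ext_Z (σ τ : QSpace q 3 → QSpace q 3)
    (D D' : QSpace q 3 →ₗ[ℂ] QSpace q 3) (h : D 1 = D' 1)
    (hD : ∀ a b, D (a * b) = σ a * D b + D a * τ b)
    (hD' : ∀ a b, D' (a * b) = σ a * D' b + D' a * τ b)
    (h1 : D (Z1 q) = D' (Z1 q)) (h2 : D (Z2 q) = D' (Z2 q)) (h3 : D (Z3 q) = D' (Z3 q))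
    (a : QSpace q 3) : D a = D' a :=
  QSpace.twistedDerivation_ext σ τ D D' h hD hD' (fun i => by fin_cases i <;> assumption) a

theorem exists_twistedDerivation_Z (σ τ : QSpace q 3 →ₐ[ℂ] QSpace q 3) (d₁ d₂ d₃ : QSpace q 3)
    (h21 : σ (Z2 q) * d₁ + d₂ * τ (Z1 q) = q • (σ (Z1 q) * d₂ + d₁ * τ (Z2 q)))
    (h31 : σ (Z3 q) * d₁ + d₃ * τ (Z1 q) = q • (σ (Z1 q) * d₃ + d₁ * τ (Z3 q)))
    (h32 : σ (Z3 q) * d₂ + d₃ * τ (Z2 q) = q • (σ (Z2 q) * d₃ + d₂ * τ (Z3 q))) :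
    ∃ D : QSpace q 3 →ₗ[ℂ] QSpace q 3, D 1 = 0 ∧
      (∀ a b, D (a * b) = σ a * D b + D a * τ b) ∧
      D (Z1 q) = d₁ ∧ D (Z2 q) = d₂ ∧ D (Z3 q) = d₃ := by
  obtain ⟨D, h1, hD, h⟩ := QSpace.exists_twistedDerivation σ τ ![d₁, d₂, d₃] (by
    intro i j hij
    fin_cases i <;> fin_cases j <;> first
      | exact absurd hij (by decide)
      | assumption)
  exact ⟨D, h1, hD, h 0, h 1, h 2⟩

variable (q) in
/-- The algebra endomorphism rescaling the generators. -/
def rescale (c : Fin 3 → ℂ) : QSpace q 3 →ₐ[ℂ] QSpace q 3 :=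
  QSpace.lift (fun i => c i • Xg q 3 i) (fun i j hij => by
    rw [smul_mul_smul_comm, smul_mul_smul_comm, QSpace.Xg_mul_Xg q hij, smul_smul, smul_smul]
    congr 1
    ring)

theorem rescale_comp_rescale {c d : Fin 3 → ℂ} (h : ∀ i, c i * d i = 1) :
    (rescale q c).comp (rescale q d) = AlgHom.id ℂ _ := by
  apply algHom_ext_Z <;>
    simp [rescale, Z1, Z2, Z3, smul_smul, mul_comm (d _), h]

variable (q) in
/-- The algebra automorphism rescaling the generators by nonzero scalars. -/
def rescaleEquiv (c : Fin 3 → ℂ) (h : ∀ i, c i ≠ 0) : QSpace q 3 ≃ₐ[ℂ] QSpace q 3 :=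
  AlgEquiv.ofAlgHom (rescale q c) (rescale q fun i => (c i)⁻¹)
    (rescale_comp_rescale fun i => mul_inv_cancel₀ (h i))
    (rescale_comp_rescale fun i => inv_mul_cancel₀ (h i))

theorem exists_uqslMA_desc4 (hq : q ≠ 0) (hq' : ∀ N : ℕ, 0 < N → q ^ N ≠ 1)
    (a₀ ξ₁ ξ₂ ξ₃ ξ₄ : ℂ) (ha : a₀ ≠ 0) :
    ∃ π : UqslMA q 1 (QSpace q 3), Desc4 q π a₀ ξ₁ ξ₂ ξ₃ ξ₄ := by
  obtain ⟨k, h1, h2, h3, s1, s2, s3⟩ : ∃ k : QSpace q 3 ≃ₐ[ℂ] QSpace q 3,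
      k (Z1 q) = (q⁻¹ * q⁻¹) • Z1 q ∧ k (Z2 q) = q⁻¹ • Z2 q ∧ k (Z3 q) = q⁻¹ • Z3 q ∧
      k.symm (Z1 q) = (q * q) • Z1 q ∧ k.symm (Z2 q) = q • Z2 q ∧ k.symm (Z3 q) = q • Z3 q := by
    refine ⟨rescaleEquiv q ![q⁻¹ * q⁻¹, q⁻¹, q⁻¹] ?_, ?_, ?_, ?_, ?_, ?_, ?_⟩
    · intro i
      fin_cases i <;> simp [hq]
    all_goals simp [rescaleEquiv, rescale, Z1, Z2, Z3]
  have q2 : q ^ 2 - 1 ≠ 0 := sub_ne_zero.2 (hq' 2 two_pos)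
  have qq : q - q⁻¹ ≠ 0 := by
    intro h
    apply q2
    field_simp at h
    linear_combination h
  obtain ⟨e, e_one, e_mul, e1, e2, e3⟩ := exists_twistedDerivation_Z (AlgHom.id ℂ _)
    (k : QSpace q 3 →ₐ[ℂ] QSpace q 3) (a₀ • 1) 0 0
    (by simp [h2, smul_smul, hq])
    (by simp [h3, smul_smul, hq]) (by simp)
  obtain ⟨f, f_one, f_mul, f1, f2, f3⟩ := exists_twistedDerivation_Z
    (k.symm : QSpace q 3 →ₐ[ℂ] QSpace q 3) (AlgHom.id ℂ _) ((-q * a₀⁻¹) • (Z1 q ^ 2))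
    ((-q * a₀⁻¹) • (Z1 q * Z2 q) + ξ₁ • (Z2 q * Z3 q ^ 2) + ξ₂ • (Z2 q ^ 3) + ξ₃ • (Z3 q ^ 3))
    ((-q * a₀⁻¹) • (Z1 q * Z3 q) + ξ₄ • (Z2 q * Z3 q ^ 2)
      + ((1 + q + q ^ 2) * ξ₂) • (Z2 q ^ 2 * Z3 q) - (q⁻¹ * ξ₁) • (Z3 q ^ 3))
    (by
      change k.symm (Z2 q) * _ + _ * Z1 q = q • (k.symm (Z1 q) * _ + _ * Z2 q)
      simp only [s1, s2, pow_succ, pow_zero, one_mul,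
        mul_add, add_mul, smul_add, mul_smul_comm, smul_mul_assoc, mul_assoc, smul_smul,
        Z2_mul_Z1, Z3_mul_Z1, Z2_mul_Z1_mul, Z3_mul_Z1_mul]
      module)
    (by
      change k.symm (Z3 q) * _ + _ * Z1 q = q • (k.symm (Z1 q) * _ + _ * Z3 q)
      simp only [s1, s3, pow_succ, pow_zero, one_mul,
        mul_add, add_mul, mul_sub, sub_mul, smul_sub, smul_add, mul_smul_comm, smul_mul_assoc,
        mul_assoc, smul_smul,
        Z3_mul_Z1, Z2_mul_Z1_mul, Z3_mul_Z1_mul]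
      module)
    (by
      change k.symm (Z3 q) * _ + _ * Z2 q = q • (k.symm (Z2 q) * _ + _ * Z3 q)
      simp only [s2, s3, pow_succ, pow_zero, one_mul,
        mul_add, add_mul, mul_sub, sub_mul, smul_sub, smul_add, mul_smul_comm, smul_mul_assoc,
        mul_assoc, smul_smul,
        Z3_mul_Z2, Z2_mul_Z1_mul, Z3_mul_Z1_mul, Z3_mul_Z2_mul]
      match_scalars <;> field_simp <;> ring)
  replace e_mul : ∀ a b, e (a * b) = a * e b + e a * k b := e_mul
  replace f_mul : ∀ a b, f (a * b) = k.symm a * f b + f a * b := f_mul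
  have ke : ∀ a, k (e a) = q ^ 2 • e (k a) :=
    twistedDerivation_ext_Z k (fun a => k (k a)) (k.toLinearMap ∘ₗ e)
      (q ^ 2 • (e ∘ₗ k.toLinearMap)) (by simp [e_one]) (by simp [e_mul])
      (by simp [e_mul]) (by simp [e1, h1, smul_smul]; field_simp) (by simp [e2, h2])
      (by simp [e3, h3])
  have kf : ∀ a, k (f a) = (q ^ 2)⁻¹ • f (k a) :=
    twistedDerivation_ext_Z id k (k.toLinearMap ∘ₗ f)
      ((q ^ 2)⁻¹ • (f ∘ₗ k.toLinearMap)) (by simp [f_one]) (by simp [f_mul])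
      (by simp [f_mul])
      (by simp [f1, h1, smul_pow]; match_scalars; field_simp)
      (by simp [f2, h1, h2, h3, smul_pow]; match_scalars <;> field_simp)
      (by simp [f3, h1, h2, h3, smul_pow]; match_scalars <;> field_simp)
  have ksymm_e : ∀ a, e (k.symm a) = q ^ 2 • k.symm (e a) := by
    intro a
    rw [← map_smul, AlgEquiv.eq_symm_apply, ke, AlgEquiv.apply_symm_apply]
  have fk : ∀ a, f (k a) = q ^ 2 • k (f a) := by
    intro a
    rw [kf, smul_smul, mul_inv_cancel₀ (pow_ne_zero 2 hq), one_smul]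
  have ef : ∀ a, e (f a) - f (e a) = (q - q⁻¹)⁻¹ • (k a - k.symm a) :=
    twistedDerivation_ext_Z k.symm k (e ∘ₗ f - f ∘ₗ e)
      ((q - q⁻¹)⁻¹ • (k.toLinearMap - k.symm.toLinearMap)) (by simp [e_one, f_one])
      (by
        intro a b
        simp [e_mul, f_mul, ksymm_e, fk, mul_sub, sub_mul]
        abel)
      (by
        intro a b
        simp [mul_sub, sub_mul, ← smul_add])
      (by
        simp [e1, f1, f_one, pow_two, e_mul, h1, s1]
        match_scalars
        field_simp
        ring)
      (by
        simp [e1, e2, e3, f2, e_mul, h2, s2, pow_succ]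
        match_scalars
        field_simp
        ring)
      (by
        simp [e1, e2, e3, f3, e_mul, h3, s3, pow_succ]
        match_scalars
        field_simp
        ring)
  have cartan_ne : ∀ (i j : Fin 1) (z : ℤ), z ≠ 2 → cartan 1 i j ≠ z := by
    intro i j z hz
    simp [cartan, Subsingleton.elim i j, hz.symm]
  exact ⟨{
    k := fun _ => k
    e := fun _ => e
    f := fun _ => f
    e_mul := fun _ => e_mul
    f_mul := fun _ => f_mul
    e_one := fun _ => e_one
    f_one := fun _ => f_one
    k_comm := fun _ _ _ => rfl
    ke := fun i j a => by
      simpa [cartan, Subsingleton.elim i j] using ke (k.symm a)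
    kf := fun i j a => by
      simpa [cartan, Subsingleton.elim i j, zpow_neg] using kf (k.symm a)
    ef := fun i j a => by rw [if_pos (Subsingleton.elim i j), ef]
    ee_comm := fun i j h => absurd h (cartan_ne i j _ (by decide))
    ff_comm := fun i j h => absurd h (cartan_ne i j _ (by decide))
    serre_e := fun i j h => absurd h (cartan_ne i j _ (by decide))
    serre_f := fun i j h => absurd h (cartan_ne i j _ (by decide)) },
    by simp [h1, zpow_neg, pow_two], h2, h3, e1, e2, e3, f1, f2, f3⟩

end QuantumThreeSpace

/-- Classification of `U_q(sl(2))`-module-algebra structures on `A_q(3)` with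
`k = (q⁻², q⁻¹, q⁻¹)` on the generators, together with the converse existence. -/
theorem Uqsl2_on_Aq3_case2 (q : ℂ) (hq : q ≠ 0)
    (hq' : ∀ N : ℕ, 0 < N → q ^ N ≠ 1) :
    (∀ π : UqslMA q 1 (QSpace q 3),
      π.k 0 (Z1 q) = (q ^ (-2 : ℤ)) • Z1 q →
      π.k 0 (Z2 q) = q⁻¹ • Z2 q →
      π.k 0 (Z3 q) = q⁻¹ • Z3 q →
      ∃ a₀ ξ₁ ξ₂ ξ₃ ξ₄ : ℂ, a₀ ≠ 0 ∧ Desc4 q π a₀ ξ₁ ξ₂ ξ₃ ξ₄) ∧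
    (∀ a₀ ξ₁ ξ₂ ξ₃ ξ₄ : ℂ, a₀ ≠ 0 →
      ∃ π : UqslMA q 1 (QSpace q 3), Desc4 q π a₀ ξ₁ ξ₂ ξ₃ ξ₄) := by
  exact ⟨fun π h1 h2 h3 => exists_desc4 hq hq' π h1 h2 h3,
    fun a₀ ξ₁ ξ₂ ξ₃ ξ₄ ha => exists_uqslMA_desc4 hq hq' a₀ ξ₁ ξ₂ ξ₃ ξ₄ ha⟩
end
end
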